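/- arXiv:1710.08722 — 2 statements merged into one kernel-verified Lean document; each statement's English description precedes it below -/
import Mathlib

section
/- For every C₁ > 0 there exists a constant C depending only on C₁ such that for every s ∈ (1/2,1) the following holds. Let γ ⊂ S² be a finite disjoint union of closed simple C² arc-length curves on S² with unit normal field ν, let C_γ := {r x̂ : r > 0, x̂ ∈ γ} be the cone over γ, and extend ν to C_γ by ν(r x̂) := ν(x̂). Assume: (i) (stability) for every C² function ζ : (0,∞) → ℝ with compact support in (0,∞), ∫_{C_γ} (∫_{C_γ} |ν(x)−ν(y)|² |x−y|^{−3−s} dH²(y)) ζ(|x|)² dH²(x) ≤ ∬_{C_γ×C_γ} |ζ(|x|)−ζ(|y|)|² |x−y|^{−3−s} dH²(x) dH²(y); and (ii) (density bound) H¹(γ ∩ B_ρ(p)) ≤ C₁ ρ/(1−s) for every p ∈ γ and every ρ ∈ (0,1/2). Then ∬_{γ×γ} |ν(x̂)−ν(ŷ)|² k_s(x̂,ŷ) dH¹(x̂) dH¹(ŷ) ≤ C H¹(γ). -/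
open MeasureTheory
open scoped ENNReal RealInnerProductSpace

noncomputable section

abbrev E3 := EuclideanSpace ℝ (Fin 3)

/-- Cross product in `ℝ³` (Euclidean). -/
def cross (a b : E3) : E3 :=
  (WithLp.equiv 2 (Fin 3 → ℝ)).symm
    ![a 1 * b 2 - a 2 * b 1, a 2 * b 0 - a 0 * b 2, a 0 * b 1 - a 1 * b 0]

/-- The kernel `k_s(x̂,ŷ) = ∫_0^∞ t (t² + 1 − 2t x̂·ŷ)^{−(3+s)/2} dt ∈ [0,∞]`. -/
def kernelK (s : ℝ) (x y : E3) : ℝ≥0∞ :=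
  ∫⁻ t in Set.Ioi (0:ℝ), ENNReal.ofReal (t * (t ^ 2 + 1 - 2 * t * ⟪x, y⟫) ^ (-(3 + s)/2))

/-- The open cone over a subset `γ` of the unit sphere. -/
def coneOver (γ : Set E3) : Set E3 := {x | ∃ r : ℝ, 0 < r ∧ ∃ v ∈ γ, x = r • v}

/-- `γ` is a finite disjoint union of closed simple `C²` arc-length curves on `S²` with
unit normal field `ν` (given on each curve by `± γᵢ × γᵢ'`). -/
def IsCurveUnion (γ : Set E3) (ν : E3 → E3) : Prop :=
  ∃ (J : ℕ) (_ : 1 ≤ J) (γi : Fin J → ℝ → E3) (L : Fin J → ℝ) (ε : Fin J → ℝ),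
    (∀ i, 0 < L i) ∧
    (∀ i, ContDiff ℝ 2 (γi i)) ∧
    (∀ i t, ‖γi i t‖ = 1) ∧
    (∀ i, Function.Periodic (γi i) (L i)) ∧
    (∀ i t, ‖deriv (γi i) t‖ = 1) ∧
    (∀ i, Set.InjOn (γi i) (Set.Ico 0 (L i))) ∧
    (∀ i j, i ≠ j → Disjoint (Set.range (γi i)) (Set.range (γi j))) ∧
    γ = ⋃ i, Set.range (γi i) ∧
    (∀ i, ε i = 1 ∨ ε i = -1) ∧
    (∀ i t, ν (γi i t) = ε i • cross (γi i t) (deriv (γi i) t))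

lemma scale_lint (s : ℝ) (v w : E3) (r : ℝ) (hr : 0 < r) (g : ℝ → ℝ≥0∞) :
    ∫⁻ ρ in Set.Ioi (0:ℝ), ENNReal.ofReal ρ *
        (g (ρ / r) * ENNReal.ofReal (‖r • v - ρ • w‖ ^ (-(3:ℝ) - s)))
      = ENNReal.ofReal (r ^ (-1 - s)) * ∫⁻ t in Set.Ioi (0:ℝ), ENNReal.ofReal t *
        (g t * ENNReal.ofReal (‖v - t • w‖ ^ (-(3:ℝ) - s))) := by
  have himg : (fun t : ℝ => r * t) '' Set.Ioi (0:ℝ) = Set.Ioi 0 := by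
    ext x
    simp only [Set.mem_image, Set.mem_Ioi]
    constructor
    · rintro ⟨t, ht, rfl⟩; positivity
    · intro hx
      exact ⟨x / r, by positivity, by field_simp⟩
  have h := lintegral_image_eq_lintegral_abs_deriv_mul (s := Set.Ioi (0:ℝ))
    (f := fun t => r * t) (f' := fun _ => r) measurableSet_Ioi
    (fun x _ => by simpa using ((hasDerivAt_id x).const_mul r).hasDerivWithinAt)
    (fun x _ y _ hxy => by simpa [hr.ne'] using hxy)
    (fun ρ => ENNReal.ofReal ρ *
        (g (ρ / r) * ENNReal.ofReal (‖r • v - ρ • w‖ ^ (-(3:ℝ) - s))))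
  rw [himg] at h
  rw [h, ← lintegral_const_mul' _ _ ENNReal.ofReal_ne_top]
  refine setLIntegral_congr_fun measurableSet_Ioi (fun t ht => ?_)
  have ht : 0 < t := ht
  have e1 : r * t / r = t := by field_simp
  have e2 : ‖r • v - (r * t) • w‖ = r * ‖v - t • w‖ := by
    rw [mul_smul, ← smul_sub, norm_smul, Real.norm_of_nonneg hr.le]
  simp only [e1, e2, abs_of_pos hr]
  rw [Real.mul_rpow hr.le (norm_nonneg _), ENNReal.ofReal_mul (p := r) hr.le,
    ENNReal.ofReal_mul (p := r ^ _) (by positivity)]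
  have e3 : ENNReal.ofReal (r ^ (-1 - s)) =
      ENNReal.ofReal r * ENNReal.ofReal r * ENNReal.ofReal (r ^ (-(3:ℝ) - s)) := by
    rw [← ENNReal.ofReal_mul hr.le, ← ENNReal.ofReal_mul (by positivity)]
    congr 1
    have : (-1 - s) = 1 + 1 + (-(3:ℝ) - s) := by ring
    rw [this, Real.rpow_add hr, Real.rpow_add hr, Real.rpow_one]
  rw [e3]
  ring

lemma kernelK_eq (s : ℝ) (v w : E3) (hv : ‖v‖ = 1) (hw : ‖w‖ = 1) :
    kernelK s v w = ∫⁻ t in Set.Ioi (0:ℝ), ENNReal.ofReal t *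
        ENNReal.ofReal (‖v - t • w‖ ^ (-(3:ℝ) - s)) := by
  unfold kernelK
  refine setLIntegral_congr_fun measurableSet_Ioi (fun t ht => ?_)
  have ht : 0 < t := ht
  beta_reduce
  rw [← ENNReal.ofReal_mul ht.le]
  congr 2
  have : t ^ 2 + 1 - 2 * t * ⟪v, w⟫ = ‖v - t • w‖ ^ (2:ℝ) := by
    rw [Real.rpow_two, norm_sub_sq_real, norm_smul, inner_smul_right, hv, hw,
      Real.norm_of_nonneg ht.le]
    ring
  rw [this, ← Real.rpow_mul (norm_nonneg _)]
  congr 1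
  ring

lemma t_log_sq_le (t : ℝ) (ht : 0 < t) : t * (Real.log t) ^ 2 ≤ (t - 1) ^ 2 := by
  set a := Real.log t / 2 with ha
  have h1 : |a| ≤ |Real.sinh a| := by
    rcases le_total 0 a with h | h
    · rw [abs_of_nonneg h, abs_of_nonneg (Real.sinh_nonneg_iff.2 h)]
      exact Real.self_le_sinh_iff.2 h
    · rw [abs_of_nonpos h, abs_of_nonpos (Real.sinh_nonpos_iff.2 h)]
      have := Real.sinh_le_self_iff.2 h
      linarith
  have h2 : a ^ 2 ≤ Real.sinh a ^ 2 := sq_le_sq.2 h1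
  have h3 : Real.exp a ^ 2 = t := by
    rw [← Real.exp_nat_mul, ha]
    push_cast
    rw [mul_div_cancel₀ _ (by norm_num : (2:ℝ) ≠ 0), Real.exp_log ht]
  have h4 : Real.log t = 2 * a := by rw [ha]; ring
  have h5 : Real.exp a * Real.exp (-a) = 1 := by rw [← Real.exp_add]; simp
  have h6 : 2 * Real.sinh a = Real.exp a - Real.exp (-a) := by rw [Real.sinh_eq]; ring
  have h7 : t - 1 = Real.exp a * (2 * Real.sinh a) := by
    rw [h6, mul_sub, h5, ← h3]; ring
  rw [h7, h4, mul_pow (Real.exp a), h3]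
  nlinarith

/-- integral of powers on `(0,b]`. -/
lemma lint_pow (s b : ℝ) (hs : s < 1) (hb : 0 ≤ b) :
    ∫⁻ r in Set.Ioc 0 b, ENNReal.ofReal (r ^ (-s)) = ENNReal.ofReal (b ^ (1 - s) / (1 - s)) := by
  have hi := (intervalIntegral.intervalIntegrable_rpow' (a := 0) (b := b) (r := -s) (by linarith))
  rw [← ofReal_integral_eq_lintegral_ofReal ((intervalIntegrable_iff_integrableOn_Ioc_of_le hb).1 hi)]
  · rw [← intervalIntegral.integral_of_le hb, integral_rpow (Or.inl (by linarith))]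
    rw [Real.zero_rpow (by linarith)]
    ring_nf
  · filter_upwards [ae_restrict_mem measurableSet_Ioc] with x hx
    exact Real.rpow_nonneg hx.1.le _

lemma lint_tail (s d : ℝ) (hs : 0 < s) (hd : 0 < d) :
    ∫⁻ r in Set.Ioi d, ENNReal.ofReal (r ^ (-1 - s)) = ENNReal.ofReal (d ^ (-s) / s) := by
  rw [← ofReal_integral_eq_lintegral_ofReal (integrableOn_Ioi_rpow_of_lt (by linarith) hd)]
  · rw [integral_Ioi_rpow_of_lt (by linarith) hd]
    congr 1
    have : (-1 - s + 1) = -s := by ring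
    rw [this, neg_div_neg_eq]
  · filter_upwards [ae_restrict_mem measurableSet_Ioi] with x hx
    exact Real.rpow_nonneg (hd.trans hx).le _

/-- The bound of the log-weighted kernel. -/
lemma Q_bound (s : ℝ) (hs : s ∈ Set.Ioo (1/2:ℝ) 1) (v w : E3) (hv : ‖v‖ = 1) (hw : ‖w‖ = 1)
    (hvw : v ≠ w) :
    ∫⁻ t in Set.Ioi (0:ℝ), ENNReal.ofReal t *
        (ENNReal.ofReal ((Real.log t) ^ 2) * ENNReal.ofReal (‖v - t • w‖ ^ (-(3:ℝ) - s)))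
      ≤ ENNReal.ofReal 36 * ENNReal.ofReal (dist v w ^ (-s)) := by
  obtain ⟨hs1, hs2⟩ := hs
  set d := dist v w with hd_def
  have hd : 0 < d := dist_pos.2 hvw
  have hdn : d = ‖v - w‖ := dist_eq_norm v w
  set f : ℝ → ℝ≥0∞ := fun u => if u ≤ d then ENNReal.ofReal (d ^ 2 * (d / 2) ^ (-(3:ℝ) - s))
    else ENNReal.ofReal (u ^ (-1 - s)) with hf
  have hpt : ∀ t ∈ Set.Ioi (0:ℝ), ENNReal.ofReal t *
        (ENNReal.ofReal ((Real.log t) ^ 2) * ENNReal.ofReal (‖v - t • w‖ ^ (-(3:ℝ) - s)))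
        ≤ f |t - 1| := by
    intro t ht
    have ht : 0 < t := ht
    have h1 : |t - 1| ≤ ‖v - t • w‖ := by
      have := abs_norm_sub_norm_le v (t • w)
      rw [hv, norm_smul, hw, Real.norm_of_nonneg ht.le, mul_one, abs_sub_comm] at this
      exact this
    have h2 : d ≤ ‖v - t • w‖ + |t - 1| := by
      have : v - w = (v - t • w) + (t - 1) • w := by module
      rw [hdn, this]
      refine (norm_add_le _ _).trans ?_
      rw [norm_smul, hw, mul_one, Real.norm_eq_abs]
    have h3 : d / 2 ≤ ‖v - t • w‖ := by linarith
    have hN : 0 ≤ ‖v - t • w‖ ^ (-(3:ℝ) - s) := by positivity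
    rw [← ENNReal.ofReal_mul (by positivity), ← ENNReal.ofReal_mul ht.le, ← mul_assoc]
    have h4 : t * Real.log t ^ 2 * ‖v - t • w‖ ^ (-(3:ℝ) - s) ≤
        |t - 1| ^ 2 * ‖v - t • w‖ ^ (-(3:ℝ) - s) := by
      rw [sq_abs]
      exact mul_le_mul_of_nonneg_right (t_log_sq_le t ht) hN
    refine (ENNReal.ofReal_le_ofReal h4).trans ?_
    simp only [hf]
    split_ifs with hc
    · apply ENNReal.ofReal_le_ofReal
      exact mul_le_mul (pow_le_pow_left₀ (abs_nonneg _) hc 2)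
        (Real.rpow_le_rpow_of_nonpos (by positivity) h3 (by linarith)) hN (by positivity)
    · push Not at hc
      apply ENNReal.ofReal_le_ofReal
      have hu : 0 < |t - 1| := hd.trans hc
      calc |t - 1| ^ 2 * ‖v - t • w‖ ^ (-(3:ℝ) - s)
          ≤ |t - 1| ^ 2 * |t - 1| ^ (-(3:ℝ) - s) := by
            exact mul_le_mul_of_nonneg_left
              (Real.rpow_le_rpow_of_nonpos hu h1 (by linarith)) (by positivity)
        _ = |t - 1| ^ (-1 - s) := by
            rw [← Real.rpow_two, ← Real.rpow_add hu]; congr 1; ring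
  have hIoi : ∫⁻ u in Set.Ioi (0:ℝ), f u ≤ ENNReal.ofReal 18 * ENNReal.ofReal (d ^ (-s)) := by
    rw [← Set.Ioc_union_Ioi_eq_Ioi hd.le]
    refine (lintegral_union_le _ _ _).trans ?_
    have i1 : ∫⁻ u in Set.Ioc 0 d, f u = ENNReal.ofReal (d ^ 2 * (d / 2) ^ (-(3:ℝ) - s)) *
        ENNReal.ofReal d := by
      rw [setLIntegral_congr_fun (g := fun _ => ENNReal.ofReal (d ^ 2 * (d / 2) ^ (-(3:ℝ) - s)))
        measurableSet_Ioc (fun u hu => by simp only [hf]; rw [if_pos hu.2])]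
      rw [setLIntegral_const, Real.volume_Ioc, sub_zero]
    have i2 : ∫⁻ u in Set.Ioi d, f u = ENNReal.ofReal (d ^ (-s) / s) := by
      rw [← lint_tail s d (by linarith) hd]
      refine setLIntegral_congr_fun measurableSet_Ioi (fun u hu => ?_)
      simp only [hf]
      rw [if_neg (not_le.2 hu)]
    rw [i1, i2, ← ENNReal.ofReal_mul (by positivity), ← ENNReal.ofReal_add (by positivity)
      (by have : 0 < s := by linarith
          positivity), ← ENNReal.ofReal_mul (by norm_num)]
    apply ENNReal.ofReal_le_ofReal
    have j0 : 0 < d ^ (-s) := by positivity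
    have j1 : d ^ (-s) / s ≤ 2 * d ^ (-s) := by
      rw [div_le_iff₀ (by linarith)]
      nlinarith
    have j2 : d ^ 2 * (d / 2) ^ (-(3:ℝ) - s) * d = 2 ^ (3 + s) * d ^ (-s) := by
      rw [Real.div_rpow hd.le (by norm_num), show (-(3:ℝ) - s) = -(3 + s) by ring,
        Real.rpow_neg (x := 2) (by norm_num), show -(3 + s) = -s + -3 by ring,
        Real.rpow_add hd, Real.rpow_neg (x := d) (y := 3) hd.le]
      have : d ^ (3:ℝ) = d ^ 3 := by norm_cast
      rw [this]
      field_simp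
    have j3 : (2:ℝ) ^ (3 + s) ≤ 16 := by
      calc (2:ℝ) ^ (3 + s) ≤ 2 ^ (4:ℝ) := Real.rpow_le_rpow_of_exponent_le (by norm_num) (by linarith)
        _ = 16 := by norm_num
    rw [j2]
    nlinarith
  calc _ ≤ ∫⁻ t in Set.Ioi (0:ℝ), f |t - 1| := setLIntegral_mono' measurableSet_Ioi hpt
    _ ≤ ∫⁻ t, f |t - 1| := setLIntegral_le_lintegral _ _
    _ = ∫⁻ t, f |t| := lintegral_sub_right_eq_self (fun t => f |t|) 1
    _ = ∫⁻ t in Set.Iic (0:ℝ) ∪ Set.Ioi 0, f |t| := by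
        rw [Set.Iic_union_Ioi, Measure.restrict_univ]
    _ ≤ (∫⁻ t in Set.Iic (0:ℝ), f |t|) + ∫⁻ t in Set.Ioi (0:ℝ), f |t| := lintegral_union_le _ _ _
    _ = (∫⁻ t in Set.Ioi (0:ℝ), f t) + ∫⁻ t in Set.Ioi (0:ℝ), f t := by
        congr 1
        · have h := lintegral_image_eq_lintegral_abs_deriv_mul (s := Set.Ici (0:ℝ))
            (f := fun t => -t) (f' := fun _ => -1) measurableSet_Ici
            (fun x _ => (hasDerivAt_neg x).hasDerivWithinAt)
            (fun x _ y _ hxy => by simpa using hxy) (fun t => f |t|)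
          have e : (fun t : ℝ => -t) '' Set.Ici 0 = Set.Iic 0 := by simp
          rw [e] at h
          rw [h, setLIntegral_congr Ioi_ae_eq_Ici]
          refine setLIntegral_congr_fun measurableSet_Ici (fun u hu => ?_)
          have hu : 0 ≤ u := hu
          simp [abs_of_nonneg hu]
        · refine setLIntegral_congr_fun measurableSet_Ioi (fun u hu => ?_)
          have hu : 0 < u := hu
          simp [abs_of_pos hu]
    _ ≤ ENNReal.ofReal 18 * ENNReal.ofReal (d ^ (-s)) + ENNReal.ofReal 18 * ENNReal.ofReal (d ^ (-s)) :=
        add_le_add hIoi hIoi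
    _ = ENNReal.ofReal 36 * ENNReal.ofReal (d ^ (-s)) := by
        rw [← add_mul, ← ENNReal.ofReal_add (by norm_num) (by norm_num)]
        norm_num


/-- Density bound at all scales implies the singular integral bound. -/
lemma riesz_bound (σ : Measure E3) [IsFiniteMeasure σ] (s D : ℝ) (hs : s ∈ Set.Ioo (1/2:ℝ) 1)
    (hD : 0 ≤ D) (v : E3) (hfar : ∀ᵐ w ∂σ, dist v w ≤ 2) (hne : ∀ᵐ w ∂σ, v ≠ w)
    (hdens : ∀ u, 0 < u → σ (Metric.ball v u) ≤ ENNReal.ofReal (D * u)) :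
    ∫⁻ w, ENNReal.ofReal (dist v w ^ (-s)) ∂σ ≤ ENNReal.ofReal (16 * D / (1 - s)) := by
  obtain ⟨hs1, hs2⟩ := hs
  set g : E3 → ℝ → ℝ≥0∞ := fun w u => Set.indicator {p : E3 × ℝ | dist v p.1 < p.2}
    (fun p => ENNReal.ofReal (p.2 ^ (-1 - s))) (w, u) with hg
  have hgm : Measurable (Function.uncurry g) := by
    have : Measurable (Set.indicator {p : E3 × ℝ | dist v p.1 < p.2}
      (fun p => ENNReal.ofReal (p.2 ^ (-1 - s)))) := by
      apply Measurable.indicator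
      · fun_prop
      · exact measurableSet_lt (by fun_prop) (by fun_prop)
    exact this
  have h1 : ∀ᵐ w ∂σ, ENNReal.ofReal (dist v w ^ (-s)) ≤
      ENNReal.ofReal 4 * ∫⁻ u in Set.Ioc 0 4, g w u := by
    filter_upwards [hfar, hne] with w hw1 hw2
    set d := dist v w with hd_def
    have hd : 0 < d := dist_pos.2 hw2
    have : ENNReal.ofReal ((2 * d) ^ (-1 - s)) * ENNReal.ofReal d ≤ ∫⁻ u in Set.Ioc 0 4, g w u := by
      calc _ = ∫⁻ u in Set.Ioc d (2 * d), ENNReal.ofReal ((2 * d) ^ (-1 - s)) := by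
            rw [setLIntegral_const, Real.volume_Ioc]; congr 2; ring
        _ ≤ ∫⁻ u in Set.Ioc d (2 * d), g w u := by
            refine setLIntegral_mono' measurableSet_Ioc (fun u hu => ?_)
            simp only [hg]
            rw [Set.indicator_of_mem (show (w, u) ∈ {p : E3 × ℝ | dist v p.1 < p.2} from hu.1)]
            exact ENNReal.ofReal_le_ofReal (Real.rpow_le_rpow_of_nonpos (hd.trans hu.1) hu.2
              (by linarith))
        _ ≤ _ := lintegral_mono_set (Set.Ioc_subset_Ioc hd.le (by linarith))
    refine le_trans ?_ (mul_le_mul_right this _)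
    rw [← ENNReal.ofReal_mul (by positivity), ← ENNReal.ofReal_mul (by positivity)]
    apply ENNReal.ofReal_le_ofReal
    rw [Real.mul_rpow (by norm_num) hd.le]
    have e1 : d ^ (-1 - s) * d = d ^ (-s) := by
      rw [← Real.rpow_add_one hd.ne']; congr 1; ring
    have e2 : (1/4 : ℝ) ≤ 2 ^ (-1 - s) := by
      calc (1/4 : ℝ) = 2 ^ (-2 : ℝ) := by norm_num [Real.rpow_neg]
        _ ≤ 2 ^ (-1 - s) := Real.rpow_le_rpow_of_exponent_le (by norm_num) (by linarith)
    have e3 : 0 < d ^ (-s) := by positivity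
    rw [mul_assoc, e1]
    nlinarith
  calc _ ≤ ∫⁻ w, (ENNReal.ofReal 4 * ∫⁻ u in Set.Ioc 0 4, g w u) ∂σ := lintegral_mono_ae h1
    _ = ENNReal.ofReal 4 * ∫⁻ w, (∫⁻ u in Set.Ioc 0 4, g w u) ∂σ :=
        lintegral_const_mul' _ _ ENNReal.ofReal_ne_top
    _ = ENNReal.ofReal 4 * ∫⁻ u in Set.Ioc 0 4, (∫⁻ w, g w u ∂σ) := by
        rw [lintegral_lintegral_swap hgm.aemeasurable]
    _ ≤ ENNReal.ofReal 4 * ∫⁻ u in Set.Ioc 0 4, ENNReal.ofReal D * ENNReal.ofReal (u ^ (-s)) := by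
        refine mul_le_mul_right ?_ _
        refine setLIntegral_mono' measurableSet_Ioc (fun u hu => ?_)
        have e : ∀ w, g w u = Set.indicator (Metric.ball v u)
            (fun _ => ENNReal.ofReal (u ^ (-1 - s))) w := by
          intro w
          simp only [hg, Set.indicator, Set.mem_ofPred_eq, Metric.mem_ball, dist_comm]
        simp only [e]
        rw [lintegral_indicator measurableSet_ball, setLIntegral_const]
        refine (mul_le_mul_right (hdens u hu.1) _).trans ?_
        have hu1 := hu.1
        rw [← ENNReal.ofReal_mul (by positivity), ← ENNReal.ofReal_mul hD]
        apply ENNReal.ofReal_le_ofReal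
        have e1 : u ^ (-1 - s) * u = u ^ (-s) := by
          rw [← Real.rpow_add_one hu1.ne']; congr 1; ring
        rw [← e1]
        exact le_of_eq (by ring)
    _ = ENNReal.ofReal 4 * (ENNReal.ofReal D * ENNReal.ofReal (4 ^ (1 - s) / (1 - s))) := by
        rw [lintegral_const_mul' _ _ ENNReal.ofReal_ne_top, lint_pow s 4 hs2 (by norm_num)]
    _ ≤ _ := by
        rw [← ENNReal.ofReal_mul hD, ← ENNReal.ofReal_mul (by norm_num)]
        apply ENNReal.ofReal_le_ofReal
        have : (4:ℝ) ^ (1 - s) ≤ 4 := by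
          calc (4:ℝ) ^ (1 - s) ≤ 4 ^ (1:ℝ) :=
                Real.rpow_le_rpow_of_exponent_le (by norm_num) (by linarith)
            _ = 4 := by norm_num
        have h1s : 0 < 1 - s := by linarith
        rw [show 4 * (D * ((4:ℝ) ^ (1 - s) / (1 - s))) = (4 * D * 4 ^ (1 - s)) / (1 - s) by ring]
        refine div_le_div_of_nonneg_right ?_ h1s.le
        nlinarith

/-- Number of balls needed for covering the unit ball. -/
lemma cover_bound : ∃ N : ℕ, ∀ (γ : Set E3) (_ : γ ⊆ Metric.sphere 0 1) (A : ℝ≥0∞) (σ : Measure E3),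
    (∀ p ∈ γ, σ (γ ∩ Metric.ball p (1/4)) ≤ A) → σ γ ≤ N * A := by
  obtain ⟨t, -, htf, htc⟩ := (isCompact_sphere (0:E3) 1).finite_cover_balls (e := 1/8) (by norm_num)
  refine ⟨htf.toFinset.card, fun γ hγ A σ h => ?_⟩
  have hsub : γ ⊆ ⋃ x ∈ htf.toFinset, (γ ∩ Metric.ball x (1/8)) := by
    intro y hy
    have := htc (hγ hy)
    simp only [Set.mem_iUnion] at this ⊢
    obtain ⟨x, hx, hxy⟩ := this
    exact ⟨x, by simpa using hx, hy, hxy⟩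
  calc σ γ ≤ σ (⋃ x ∈ htf.toFinset, (γ ∩ Metric.ball x (1/8))) := measure_mono hsub
    _ ≤ ∑ x ∈ htf.toFinset, σ (γ ∩ Metric.ball x (1/8)) := measure_biUnion_finset_le _ _
    _ ≤ ∑ x ∈ htf.toFinset, A := by
        refine Finset.sum_le_sum (fun x _ => ?_)
        rcases Set.eq_empty_or_nonempty (γ ∩ Metric.ball x (1/8)) with he | ⟨p, hp1, hp2⟩
        · rw [he]; simp
        · refine le_trans (measure_mono ?_) (h p hp1)
          rintro y ⟨hy1, hy2⟩
          refine ⟨hy1, ?_⟩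
          rw [Metric.mem_ball] at *
          have := dist_triangle_right y p x
          linarith
    _ = _ := by simp

/-- The cutoff. -/
lemma exists_phi : ∃ (φ : ℝ → ℝ) (K : ℝ), 0 ≤ K ∧ ContDiff ℝ 2 φ ∧ (∀ x, |x| ≤ 1 → φ x = 1) ∧
    (∀ x, 2 ≤ |x| → φ x = 0) ∧ ∀ x y, |φ x - φ y| ≤ K * |x - y| := by
  let b : ContDiffBump (0:ℝ) := ⟨1, 2, by norm_num, by norm_num⟩
  obtain ⟨K, hK⟩ := ContDiff.lipschitzWith_of_hasCompactSupport (n := 2) (𝕂 := ℝ)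
    b.hasCompactSupport b.contDiff (by norm_num)
  refine ⟨b, K, K.2, b.contDiff, fun x hx => ?_, fun x hx => ?_, fun x y => ?_⟩
  · exact b.one_of_mem_closedBall (by simpa [b] using hx)
  · exact b.zero_of_le_dist (by simpa [b] using hx)
  · simpa [Real.dist_eq] using hK.dist_le_mul x y

lemma exists_zeta : ∃ K : ℝ, 0 < K ∧ ∀ δ : ℝ, 0 < δ → ∃ ζ : ℝ → ℝ, ContDiff ℝ 2 ζ ∧
    HasCompactSupport ζ ∧ tsupport ζ ⊆ Set.Ioi (0:ℝ) ∧
    (∀ r ∈ Set.Icc 1 (Real.exp (1 / δ)), ζ r = 1) ∧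
    (∀ r, Real.exp (2 / δ) < r → ζ r = 0) ∧
    (∀ r ρ, 0 < r → 0 < ρ → (ζ r - ζ ρ) ^ 2 ≤ K * δ ^ 2 * (Real.log (ρ / r)) ^ 2) := by
  obtain ⟨φ, K, hK, hφ, h1, h0, hL⟩ := exists_phi
  refine ⟨K ^ 2 + 1, by positivity, fun δ hδ => ?_⟩
  set ζ : ℝ → ℝ := fun r => if 0 < r then φ (δ * Real.log r) else 0 with hζ
  have hsmall : ∀ r, r ≤ Real.exp (-(2 / δ)) → ζ r = 0 := by
    intro r hr
    simp only [hζ]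
    split_ifs with h
    · apply h0
      have : Real.log r ≤ -(2 / δ) := by
        rw [← Real.log_exp (-(2 / δ))]; exact Real.log_le_log h hr
      have h2 : δ * Real.log r ≤ -2 := by
        calc δ * Real.log r ≤ δ * (-(2 / δ)) := by gcongr
          _ = -2 := by field_simp
      rw [abs_of_nonpos (by linarith)]; linarith
    · rfl
  have hbig : ∀ r, Real.exp (2 / δ) ≤ r → ζ r = 0 := by
    intro r hr
    have hr0 : 0 < r := (Real.exp_pos _).trans_le hr
    simp only [hζ, if_pos hr0]
    apply h0
    have : 2 / δ ≤ Real.log r := by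
      rw [← Real.log_exp (2 / δ)]; exact Real.log_le_log (Real.exp_pos _) hr
    have h2 : 2 ≤ δ * Real.log r := by
      calc 2 = δ * (2 / δ) := by field_simp
        _ ≤ _ := by gcongr
    exact h2.trans (le_abs_self _)
  have hts : tsupport ζ ⊆ Set.Icc (Real.exp (-(2 / δ))) (Real.exp (2 / δ)) := by
    apply closure_minimal _ isClosed_Icc
    intro r hr
    by_contra hc
    rw [Set.mem_Icc, not_and_or, not_le, not_le] at hc
    rcases hc with hc | hc
    · exact hr (hsmall r hc.le)
    · exact hr (hbig r hc.le)
  refine ⟨ζ, ?_, ?_, ?_, ?_, ?_, ?_⟩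
  · rw [contDiff_iff_contDiffAt]
    intro r
    rcases lt_or_ge 0 r with hr | hr
    · have : ContDiffAt ℝ 2 (fun r => φ (δ * Real.log r)) r :=
        hφ.contDiffAt.comp r (contDiffAt_const.mul (Real.contDiffAt_log.2 hr.ne'))
      refine this.congr_of_eventuallyEq ?_
      filter_upwards [lt_mem_nhds hr] with x hx
      simp only [hζ, if_pos hx]
    · refine (contDiffAt_const (c := (0:ℝ))).congr_of_eventuallyEq ?_
      filter_upwards [gt_mem_nhds (hr.trans_lt (Real.exp_pos (-(2 / δ))))] with x hx
      exact hsmall x hx.le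
  · exact isCompact_Icc.of_isClosed_subset (isClosed_tsupport _) hts
  · intro r hr
    exact (Real.exp_pos _).trans_le (hts hr).1
  · intro r hr
    have hr0 : 0 < r := by linarith [hr.1]
    simp only [hζ, if_pos hr0]
    apply h1
    have l0 : 0 ≤ Real.log r := Real.log_nonneg hr.1
    rw [abs_of_nonneg (by positivity)]
    have : Real.log r ≤ 1 / δ := by
      rw [← Real.log_exp (1 / δ)]; exact Real.log_le_log hr0 hr.2
    calc δ * Real.log r ≤ δ * (1 / δ) := by gcongr
      _ = 1 := by field_simp
  · intro r hr; exact hbig r hr.le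
  · intro r ρ hr hρ
    simp only [hζ, if_pos hr, if_pos hρ]
    have h := hL (δ * Real.log r) (δ * Real.log ρ)
    rw [Real.log_div hρ.ne' hr.ne']
    calc _ = |φ (δ * Real.log r) - φ (δ * Real.log ρ)| ^ 2 := (sq_abs _).symm
      _ ≤ (K * |δ * Real.log r - δ * Real.log ρ|) ^ 2 := by gcongr
      _ = K ^ 2 * δ ^ 2 * (Real.log ρ - Real.log r) ^ 2 := by rw [mul_pow, sq_abs]; ring
      _ ≤ _ := by gcongr; linarith


lemma msmul_mono {X : Type*} [MeasurableSpace X] {μ ν : Measure X} (h : μ ≤ ν) (c : ℝ≥0∞) :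
    c • μ ≤ c • ν := by
  intro s
  simp only [Measure.smul_apply, smul_eq_mul]
  exact mul_le_mul_right (h s) c

lemma measure_le_of_cover {X ι : Type*} [MeasurableSpace X] [Countable ι] (μ₁ μ₂ : Measure X)
    (P : ι → Set X) (hP : ∀ i, MeasurableSet (P i)) (h0 : μ₁ (⋃ i, P i)ᶜ = 0)
    (h : ∀ i, μ₁.restrict (P i) ≤ μ₂.restrict (P i)) : μ₁ ≤ μ₂ := by
  rcases isEmpty_or_nonempty ι with he | hne
  · have : μ₁ = 0 := by
      rw [← Measure.measure_univ_eq_zero]; simpa using h0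
    rw [this]; exact Measure.zero_le _
  obtain ⟨e, he⟩ := exists_surjective_nat ι
  set D := disjointed (fun n => P (e n)) with hD
  have hDm : ∀ n, MeasurableSet (D n) := MeasurableSet.disjointed (fun n => hP _)
  have hU : (⋃ n, D n) = ⋃ i, P i := by
    rw [hD, iUnion_disjointed]
    exact he.iUnion_comp P
  have hr : ∀ n, μ₁.restrict (D n) ≤ μ₂.restrict (D n) := by
    intro n
    have hs : D n ⊆ P (e n) := disjointed_subset _ _
    have := Measure.restrict_mono_measure (h (e n)) (D n)
    rwa [Measure.restrict_restrict (hDm n), Measure.restrict_restrict (hDm n),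
      Set.inter_eq_left.2 hs] at this
  have hsum : ∀ μ : Measure X, μ.restrict (⋃ n, D n) = Measure.sum fun n => μ.restrict (D n) :=
    fun μ => Measure.restrict_iUnion (disjoint_disjointed _) hDm
  have h1 : μ₁ = μ₁.restrict (⋃ n, D n) := by
    symm
    rw [hU]
    exact Measure.restrict_eq_self_of_ae_mem (by rwa [ae_iff])
  rw [h1]
  refine le_trans ?_ (Measure.restrict_le_self (s := ⋃ n, D n))
  rw [hsum, hsum]
  intro s
  exact (Measure.le_iff.2 (fun t ht => by
    rw [Measure.sum_apply _ ht, Measure.sum_apply _ ht]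
    exact ENNReal.tsum_le_tsum (fun n => hr n t))) s

/-- Bi-Lipschitz comparison of Hausdorff measures. -/
lemma hausdorff_bilip {X Y : Type*} [MetricSpace X] [MetricSpace Y] [MeasurableSpace X]
    [MeasurableSpace Y] [BorelSpace X] [BorelSpace Y] (f : X → Y) (hf : Measurable f) (S : Set X)
    (d : ℝ) (hd : 0 ≤ d) (K K' : NNReal) (h1 : ∀ x ∈ S, ∀ y ∈ S, dist (f x) (f y) ≤ K * dist x y)
    (h2 : ∀ x ∈ S, ∀ y ∈ S, dist x y ≤ K' * dist (f x) (f y)) :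
    (μH[d] : Measure Y).restrict (f '' S) ≤ ((K : ℝ≥0∞) ^ d) • ((μH[d] : Measure X).restrict S).map f ∧
    ((μH[d] : Measure X).restrict S).map f ≤ ((K' : ℝ≥0∞) ^ d) • (μH[d] : Measure Y).restrict (f '' S) := by
  have hL : LipschitzOnWith K f S := LipschitzOnWith.of_dist_le_mul h1
  constructor
  · refine Measure.le_iff.2 (fun B hB => ?_)
    rw [Measure.restrict_apply hB, Measure.smul_apply, Measure.map_apply hf hB,
      Measure.restrict_apply (hf hB), smul_eq_mul]
    have : B ∩ f '' S = f '' (f ⁻¹' B ∩ S) := by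
      rw [Set.image_preimage_inter]
    rw [this]
    exact (hL.mono Set.inter_subset_right).hausdorffMeasure_image_le hd
  · refine Measure.le_iff.2 (fun B hB => ?_)
    rw [Measure.smul_apply, Measure.restrict_apply hB, Measure.map_apply hf hB,
      Measure.restrict_apply (hf hB), smul_eq_mul]
    rcases S.eq_empty_or_nonempty with he | ⟨x0, hx0⟩
    · simp [he]
    have : Nonempty X := ⟨x0⟩
    have hinj : Set.InjOn f S := by
      intro x hx y hy hxy
      have := h2 x hx y hy
      rw [hxy, dist_self, mul_zero] at this
      exact dist_le_zero.1 this
    set g := Function.invFunOn f S with hg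
    have hgl : ∀ x ∈ S, g (f x) = x := fun x hx => hinj.leftInvOn_invFunOn hx
    have hgL : LipschitzOnWith K' g (f '' S) := by
      refine LipschitzOnWith.of_dist_le_mul ?_
      rintro _ ⟨x, hx, rfl⟩ _ ⟨y, hy, rfl⟩
      rw [hgl x hx, hgl y hy]
      exact h2 x hx y hy
    have : f ⁻¹' B ∩ S ⊆ g '' (B ∩ f '' S) := by
      rintro x ⟨hx, hxS⟩
      exact ⟨f x, ⟨hx, x, hxS, rfl⟩, hgl x hxS⟩
    exact (measure_mono this).trans
      ((hgL.mono Set.inter_subset_right).hausdorffMeasure_image_le hd)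

def radM : Measure ℝ := (volume.restrict (Set.Ioi (0:ℝ))).withDensity (fun r => ENNReal.ofReal r)

instance : SFinite radM := by unfold radM; infer_instance

def coneT (p : ℝ × E3) : E3 := p.1 • p.2

lemma coneT_cont : Continuous coneT := by unfold coneT; fun_prop

def coneM (γ : Set E3) : Measure E3 := (radM.prod ((μH[1] : Measure E3).restrict γ)).map coneT

/-- Comparison on a piece. -/
lemma piece (γ : Set E3) (hγ : γ ⊆ Metric.sphere 0 1) (hγm : MeasurableSet γ)
    [IsFiniteMeasure ((μH[1] : Measure E3).restrict γ)]
    (a : ℝ) (ha : 0 < a) (I : Set ℝ) (hI : IsCompact I) (g : ℝ → E3) (hg : Continuous g)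
    (hgγ : g '' I ⊆ γ)
    (h1 : ∀ x ∈ I, ∀ y ∈ I, dist (g x) (g y) ≤ a⁻¹ * dist x y)
    (h2 : ∀ x ∈ I, ∀ y ∈ I, dist x y ≤ 2 * a * dist (g x) (g y)) :
    let P := coneT '' (Set.Icc a (2 * a) ×ˢ (g '' I))
    (μH[2] : Measure E3).restrict P ≤ (18 : ℝ≥0∞) • (coneM γ).restrict P ∧
    (coneM γ).restrict P ≤ (32 : ℝ≥0∞) • (μH[2] : Measure E3).restrict P := by
  intro P
  have hunit : ∀ x ∈ I, ‖g x‖ = 1 := fun x hx => by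
    simpa using hγ (hgγ ⟨x, hx, rfl⟩)
  have harc : IsCompact (g '' I) := hI.image hg
  have hPc : IsCompact P := (isCompact_Icc.prod harc).image coneT_cont
  set σ := (μH[1] : Measure E3).restrict γ with hσ
  set R := Set.Icc a (2 * a) ×ˢ I with hR
  have hRc : IsCompact R := isCompact_Icc.prod hI
  set Ψ : ℝ × ℝ → E3 := fun p => p.1 • g p.2 with hΨ
  have hΨc : Continuous Ψ := by fun_prop
  have hPR : P = Ψ '' R := by
    ext y
    constructor
    · rintro ⟨⟨r, v⟩, ⟨hr, x, hx, rfl⟩, rfl⟩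
      exact ⟨(r, x), ⟨hr, hx⟩, rfl⟩
    · rintro ⟨⟨r, x⟩, ⟨hr, hx⟩, rfl⟩
      exact ⟨(r, g x), ⟨hr, x, hx, rfl⟩, rfl⟩
  -- 2d comparison
  have key2 := hausdorff_bilip Ψ hΨc.measurable R 2 (by norm_num) 3 4
    (by
      rintro ⟨r, x⟩ ⟨hr, hx⟩ ⟨r', x'⟩ ⟨hr', hx'⟩
      simp only [hΨ]
      have e : r • g x - r' • g x' = (r - r') • g x + r' • (g x - g x') := by module
      have m1 : dist r r' ≤ dist (r, x) (r', x') := le_max_left _ _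
      have m2 : dist x x' ≤ dist (r, x) (r', x') := le_max_right _ _
      have l1 := h1 x hx x' hx'
      have hr'0 : 0 < r' := ha.trans_le hr'.1
      rw [dist_eq_norm, e]
      have l2 : r' * dist (g x) (g x') ≤ 2 * dist x x' := by
        calc r' * dist (g x) (g x') ≤ (2 * a) * (a⁻¹ * dist x x') := by
              gcongr
              exact hr'.2
          _ = 2 * dist x x' := by field_simp
      calc ‖(r - r') • g x + r' • (g x - g x')‖ ≤ ‖(r - r') • g x‖ + ‖r' • (g x - g x')‖ :=
            norm_add_le _ _
        _ = dist r r' + r' * dist (g x) (g x') := by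
            rw [norm_smul, norm_smul, hunit x hx, mul_one, Real.norm_of_nonneg hr'0.le,
              dist_eq_norm, dist_eq_norm]
        _ ≤ _ := by push_cast; linarith)
    (by
      rintro ⟨r, x⟩ ⟨hr, hx⟩ ⟨r', x'⟩ ⟨hr', hx'⟩
      simp only [hΨ]
      have hr0 : 0 < r := ha.trans_le hr.1
      have hr'0 : 0 < r' := ha.trans_le hr'.1
      have m1 : dist r r' ≤ dist (r • g x) (r' • g x') := by
        have := abs_norm_sub_norm_le (r • g x) (r' • g x')
        rw [norm_smul, norm_smul, hunit x hx, hunit x' hx', Real.norm_of_nonneg hr0.le,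
          Real.norm_of_nonneg hr'0.le, mul_one, mul_one] at this
        rwa [Real.dist_eq, dist_eq_norm]
      have m2 : a * dist (g x) (g x') ≤ dist (r • g x) (r' • g x') + dist r r' := by
        have e : r • (g x - g x') = (r • g x - r' • g x') + (r' - r) • g x' := by module
        calc a * dist (g x) (g x') ≤ r * dist (g x) (g x') := by
              gcongr; exact hr.1
          _ = ‖r • (g x - g x')‖ := by
              rw [norm_smul, Real.norm_of_nonneg hr0.le, dist_eq_norm]
          _ ≤ ‖r • g x - r' • g x'‖ + ‖(r' - r) • g x'‖ := by rw [e]; exact norm_add_le _ _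
          _ = _ := by
              rw [norm_smul, hunit x' hx', mul_one, dist_eq_norm, dist_comm r r', dist_eq_norm r' r]
      have m3 := h2 x hx x' hx'
      rw [Prod.dist_eq]
      refine max_le ?_ ?_
      · have : 0 ≤ dist (r • g x) (r' • g x') := dist_nonneg
        push_cast
        linarith
      · push_cast
        nlinarith)
  -- 1d comparison
  have key1 := hausdorff_bilip g hg.measurable I 1 (by norm_num)
    (Real.toNNReal a⁻¹) (Real.toNNReal (2 * a))
    (by rwa [Real.coe_toNNReal _ (by positivity)]) (by rwa [Real.coe_toNNReal _ (by positivity)])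
  rw [hausdorffMeasure_prod_real, ← hPR] at key2
  rw [hausdorffMeasure_real, ENNReal.rpow_one, ENNReal.rpow_one] at key1
  have hσarc : σ.restrict (g '' I) = (μH[1] : Measure E3).restrict (g '' I) := by
    rw [hσ, Measure.restrict_restrict harc.measurableSet, Set.inter_eq_left.2 hgγ]
  rw [← hσarc] at key1
  set Vr : Measure ℝ := (volume : Measure ℝ).restrict (Set.Icc a (2 * a)) with hVr
  set Vg : Measure E3 := ((volume : Measure ℝ).restrict I).map g with hVg
  have : IsFiniteMeasure ((volume : Measure ℝ).restrict I) := ⟨by simpa using hI.measure_lt_top⟩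
  have hmap : ((volume : Measure (ℝ × ℝ)).restrict R).map Ψ = (Vr.prod Vg).map coneT := by
    have e1 : (volume : Measure (ℝ × ℝ)).restrict R
        = Vr.prod ((volume : Measure ℝ).restrict I) := by
      rw [hVr, Measure.prod_restrict]; rfl
    have e2 : Vr.prod Vg = (Vr.prod ((volume : Measure ℝ).restrict I)).map (Prod.map id g) := by
      rw [← Measure.map_prod_map _ _ measurable_id hg.measurable, Measure.map_id]
    rw [e1, e2, Measure.map_map coneT_cont.measurable (by fun_prop)]
    rfl
  rw [hmap] at key2
  have hcm : (coneM γ).restrict P =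
      ((radM.restrict (Set.Icc a (2 * a))).prod (σ.restrict (g '' I))).map coneT := by
    rw [Measure.prod_restrict]
    unfold coneM
    rw [Measure.restrict_map coneT_cont.measurable hPc.measurableSet]
    congr 1
    apply Measure.restrict_congr_set
    have hsub : ∀ᵐ p ∂(radM.prod σ), 0 < p.1 ∧ p.2 ∈ γ := by
      have q1 : ∀ᵐ r ∂radM, 0 < r := by
        have : radM ≪ volume.restrict (Set.Ioi (0:ℝ)) := withDensity_absolutelyContinuous _ _
        exact this.ae_le (ae_restrict_mem measurableSet_Ioi)
      have q2 : ∀ᵐ v ∂σ, v ∈ γ := ae_restrict_mem hγm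
      exact (Measure.quasiMeasurePreserving_fst.ae q1).and (Measure.quasiMeasurePreserving_snd.ae q2)
    filter_upwards [hsub] with p hp
    obtain ⟨r, v⟩ := p
    apply propext
    constructor
    · rintro ⟨⟨r', _⟩, ⟨hr', x, hx, rfl⟩, he⟩
      have hr'0 : 0 < r' := ha.trans_le hr'.1
      simp only [coneT] at he
      have hv1 : ‖v‖ = 1 := by simpa using hγ hp.2
      have hn := congrArg norm he
      rw [norm_smul, norm_smul, hunit x hx, hv1, Real.norm_of_nonneg hr'0.le,
        Real.norm_of_nonneg hp.1.le, mul_one, mul_one] at hn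
      subst hn
      have := smul_right_injective E3 hr'0.ne' he
      exact ⟨hr', x, hx, this⟩
    · intro h
      exact ⟨(r, v), h, rfl⟩
  have hrad1 : ENNReal.ofReal a • Vr ≤ radM.restrict (Set.Icc a (2 * a)) := by
    refine Measure.le_iff.2 (fun B hB => ?_)
    rw [Measure.smul_apply, hVr, Measure.restrict_apply hB, Measure.restrict_apply hB, radM,
      withDensity_apply _ (hB.inter measurableSet_Icc),
      Measure.restrict_restrict (hB.inter measurableSet_Icc), Set.inter_eq_left.2
        (show B ∩ Set.Icc a (2 * a) ⊆ Set.Ioi 0 from fun x hx => ha.trans_le hx.2.1), smul_eq_mul, ← setLIntegral_const]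
    refine setLIntegral_mono' (hB.inter measurableSet_Icc) (fun x hx => ?_)
    exact ENNReal.ofReal_le_ofReal hx.2.1
  have hrad2 : radM.restrict (Set.Icc a (2 * a)) ≤ ENNReal.ofReal (2 * a) • Vr := by
    refine Measure.le_iff.2 (fun B hB => ?_)
    rw [Measure.smul_apply, hVr, Measure.restrict_apply hB, Measure.restrict_apply hB, radM,
      withDensity_apply _ (hB.inter measurableSet_Icc),
      Measure.restrict_restrict (hB.inter measurableSet_Icc), Set.inter_eq_left.2
        (show B ∩ Set.Icc a (2 * a) ⊆ Set.Ioi 0 from fun x hx => ha.trans_le hx.2.1), smul_eq_mul, ← setLIntegral_const]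
    refine setLIntegral_mono' (hB.inter measurableSet_Icc) (fun x hx => ?_)
    exact ENNReal.ofReal_le_ofReal hx.2.2
  change _ ≤ ENNReal.ofReal a⁻¹ • Vg ∧ Vg ≤ ENNReal.ofReal (2 * a) • _ at key1
  set A := (radM.restrict (Set.Icc a (2 * a))) with hA
  set S := σ.restrict (g '' I) with hS
  have : IsFiniteMeasure Vg := by rw [hVg]; infer_instance
  have : SFinite (ENNReal.ofReal a⁻¹ • Vg) := inferInstance
  have : SFinite S := by rw [hS]; infer_instance
  have P1 : (Vr.prod Vg).map coneT ≤ (2:ℝ≥0∞) • (A.prod S).map coneT := by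
    rw [← Measure.map_smul]
    refine Measure.map_mono ?_ coneT_cont.measurable
    have hVr' : Vr ≤ ENNReal.ofReal a⁻¹ • A := by
      have := msmul_mono hrad1 (ENNReal.ofReal a⁻¹)
      rwa [smul_smul, ← ENNReal.ofReal_mul (by positivity), inv_mul_cancel₀ ha.ne',
        ENNReal.ofReal_one, one_smul] at this
    calc Vr.prod Vg ≤ (ENNReal.ofReal a⁻¹ • A).prod (ENNReal.ofReal (2 * a) • S) :=
          Measure.prod_mono hVr' key1.2
      _ = (2:ℝ≥0∞) • (A.prod S) := by
          rw [Measure.prod_smul_right, Measure.prod_smul_left, smul_smul,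
            ← ENNReal.ofReal_mul (by positivity)]
          congr 1
          rw [show 2 * a * a⁻¹ = 2 by field_simp]
          simp
  have P2 : (A.prod S).map coneT ≤ (2:ℝ≥0∞) • (Vr.prod Vg).map coneT := by
    rw [← Measure.map_smul]
    refine Measure.map_mono ?_ coneT_cont.measurable
    calc A.prod S ≤ (ENNReal.ofReal (2 * a) • Vr).prod (ENNReal.ofReal a⁻¹ • Vg) :=
          Measure.prod_mono hrad2 key1.1
      _ = (2:ℝ≥0∞) • (Vr.prod Vg) := by
          rw [Measure.prod_smul_right, Measure.prod_smul_left, smul_smul,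
            ← ENNReal.ofReal_mul (by positivity)]
          congr 1
          rw [show a⁻¹ * (2 * a) = 2 by field_simp]
          simp
  rw [hcm]
  constructor
  · refine key2.1.trans ?_
    refine (msmul_mono P1 _).trans ?_
    rw [smul_smul]
    refine le_of_eq ?_
    congr 1
    norm_num
  · refine P2.trans ?_
    refine (msmul_mono key2.2 _).trans ?_
    rw [smul_smul]
    refine le_of_eq ?_
    congr 1
    norm_num


lemma local_bilip (f : ℝ → E3) (hf : ContDiff ℝ 2 f) (h1 : ∀ t, ‖deriv f t‖ = 1) (t₀ : ℝ) :
    ∃ U ∈ nhds t₀, IsCompact U ∧ ∀ x ∈ U, ∀ y ∈ U, dist x y ≤ 2 * dist (f x) (f y) := by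
  have hs : HasStrictDerivAt f (deriv f t₀) t₀ :=
    (hf.contDiffAt.hasStrictDerivAt (by norm_num))
  obtain ⟨S, hS, hA⟩ := hs.hasStrictFDerivAt.approximates_deriv_on_nhds (c := 1/2)
    (Or.inr (by norm_num))
  obtain ⟨ε, hε, hb⟩ := Metric.nhds_basis_closedBall.mem_iff.1 hS
  refine ⟨Metric.closedBall t₀ ε, Metric.closedBall_mem_nhds _ hε, isCompact_closedBall _ _, ?_⟩
  intro x hx y hy
  have h := hA x (hb hx) y (hb hy)
  simp only [ContinuousLinearMap.toSpanSingleton_apply] at h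
  have h2 : ‖(x - y) • deriv f t₀‖ = dist x y := by
    rw [norm_smul, h1, mul_one, dist_eq_norm]
  have h3 := norm_sub_norm_le ((x - y) • deriv f t₀) (f x - f y)
  rw [norm_sub_rev ((x - y) • deriv f t₀) (f x - f y), h2, ← dist_eq_norm] at h3
  rw [← dist_eq_norm x y] at h
  have h4 : (((1/2 : NNReal)) : ℝ) = 1/2 := by norm_num
  rw [h4] at h
  linarith

lemma curve_compact {γ : Set E3} {ν : E3 → E3} (h : IsCurveUnion γ ν) : IsCompact γ := by
  obtain ⟨J, -, c, L, ε, hL, hc, hn, hp, hd, -, -, rfl, -, -⟩ := h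
  refine isCompact_iUnion (fun i => ?_)
  exact ((hp i).compact_of_continuous (hL i).ne' (hc i).continuous)

lemma curve_sphere {γ : Set E3} {ν : E3 → E3} (h : IsCurveUnion γ ν) : γ ⊆ Metric.sphere 0 1 := by
  obtain ⟨J, -, c, L, ε, hL, hc, hn, hp, hd, -, -, rfl, -, -⟩ := h
  intro x hx
  obtain ⟨i, t, rfl⟩ := Set.mem_iUnion.1 hx
  simpa using hn i t

lemma cross_cont : Continuous (fun p : E3 × E3 => cross p.1 p.2) := by
  unfold cross
  refine (PiLp.continuous_toLp 2 (fun _ : Fin 3 => ℝ)).comp ?_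
  refine continuous_pi (fun i => ?_)
  fin_cases i <;> simp <;> fun_prop

lemma curve_nu_meas {γ : Set E3} {ν : E3 → E3} (h : IsCurveUnion γ ν) :
    Measurable (γ.indicator ν) := by
  have hγm := (curve_compact h).measurableSet
  obtain ⟨J, -, c, L, ε, hL, hc, hn, hp, hd, -, -, rfl, -, hν⟩ := h
  have hcl : ∀ F : Set E3, IsClosed F → MeasurableSet ((⋃ i, Set.range (c i)) ∩ ν ⁻¹' F) := by
    intro F hF
    rw [Set.iUnion_inter]
    refine MeasurableSet.iUnion (fun i => ?_)
    have hcont : Continuous (fun t => ν (c i t)) := by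
      simp only [hν]
      have hd' : Continuous (deriv (c i)) := (hc i).continuous_deriv (by norm_num)
      exact (cross_cont.comp ((hc i).continuous.prodMk hd')).const_smul (ε i)
    have he : Set.range (c i) ∩ ν ⁻¹' F =
        c i '' (Set.Icc 0 (L i) ∩ (fun t => ν (c i t)) ⁻¹' F) := by
      ext x
      constructor
      · rintro ⟨⟨t, rfl⟩, ht⟩
        obtain ⟨t', ht', he⟩ := (hp i).exists_mem_Ico₀ (hL i) t
        refine ⟨t', ⟨⟨ht'.1, ht'.2.le⟩, ?_⟩, he.symm⟩
        change ν (c i t') ∈ F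
        rw [← he]; exact ht
      · rintro ⟨t, ⟨-, ht⟩, rfl⟩
        exact ⟨⟨t, rfl⟩, ht⟩
    rw [he]
    exact ((isCompact_Icc.inter_right (hF.preimage hcont)).image (hc i).continuous).measurableSet
  refine measurable_of_isClosed (fun F hF => ?_)
  have : (Set.indicator (⋃ i, Set.range (c i)) ν) ⁻¹' F =
      ((⋃ i, Set.range (c i)) ∩ ν ⁻¹' F) ∪ ((⋃ i, Set.range (c i))ᶜ ∩ {_x | (0:E3) ∈ F}) := by
    ext x
    by_cases hx : x ∈ ⋃ i, Set.range (c i)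
    · rw [Set.mem_preimage, Set.indicator_of_mem hx]
      simp only [Set.mem_union, Set.mem_inter_iff, hx, Set.mem_compl_iff, not_true, true_and,
        false_and, or_false, Set.mem_preimage]
    · rw [Set.mem_preimage, Set.indicator_of_notMem hx]
      simp only [Set.mem_union, Set.mem_inter_iff, hx, Set.mem_compl_iff, not_false_iff, true_and,
        false_and, false_or]
      rfl
  rw [this]
  exact (hcl F hF).union (hγm.compl.inter (MeasurableSet.const _))

lemma mem_cone_iff {γ : Set E3} (hγ : γ ⊆ Metric.sphere 0 1) (x : E3) :
    x ∈ coneOver γ ↔ x ≠ 0 ∧ ‖x‖⁻¹ • x ∈ γ := by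
  constructor
  · rintro ⟨r, hr, v, hv, rfl⟩
    have hv1 : ‖v‖ = 1 := by simpa using hγ hv
    have hv0 : v ≠ 0 := by rintro rfl; simp at hv1
    refine ⟨smul_ne_zero hr.ne' hv0, ?_⟩
    rw [norm_smul, hv1, mul_one, Real.norm_of_nonneg hr.le, smul_smul, inv_mul_cancel₀ hr.ne',
      one_smul]
    exact hv
  · rintro ⟨h0, hx⟩
    have : 0 < ‖x‖ := norm_pos_iff.2 h0
    refine ⟨‖x‖, this, _, hx, ?_⟩
    rw [smul_smul, mul_inv_cancel₀ this.ne', one_smul]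

lemma cone_meas {γ : Set E3} (hγ : γ ⊆ Metric.sphere 0 1) (hm : MeasurableSet γ) :
    MeasurableSet (coneOver γ) := by
  have : coneOver γ = {0}ᶜ ∩ (fun x : E3 => ‖x‖⁻¹ • x) ⁻¹' γ := by
    ext x
    rw [mem_cone_iff hγ]
    rfl
  rw [this]
  have hf : Measurable (fun x : E3 => ‖x‖⁻¹ • x) := by fun_prop
  exact (measurableSet_singleton _).compl.inter (hf hm)

lemma cone_compare {γ : Set E3} {ν : E3 → E3} (h : IsCurveUnion γ ν)
    [IsFiniteMeasure ((μH[1] : Measure E3).restrict γ)] :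
    (μH[2] : Measure E3).restrict (coneOver γ) ≤ (18 : ℝ≥0∞) • coneM γ ∧
    coneM γ ≤ (32 : ℝ≥0∞) • (μH[2] : Measure E3).restrict (coneOver γ) := by
  have hγs := curve_sphere h
  have hγm := (curve_compact h).measurableSet
  have hcm := cone_meas hγs hγm
  obtain ⟨J, -, c, L, ε, hL, hc, hn, hp, hd, -, -, hγ, -, hν⟩ := h
  choose U hU hUc hUb using fun i t => local_bilip (c i) (hc i) (hd i) t
  choose T hT hTU using fun i => countable_cover_nhds (hU i)
  have : ∀ i, Countable (T i) := fun i => (hT i).to_subtype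
  let a : ℤ → ℝ := fun k => (2:ℝ) ^ k
  have ha : ∀ k, 0 < a k := fun k => by positivity
  let g : Fin J → ℤ → ℝ → E3 := fun i k τ => c i ((a k)⁻¹ * τ)
  let I : ∀ i : Fin J, ℝ → ℤ → Set ℝ := fun i t k => (fun x => a k * x) '' U i t
  have hgI : ∀ i t k, g i k '' I i t k = c i '' U i t := by
    intro i t k
    simp only [g, I, Set.image_image]
    congr 1
    ext x
    rw [inv_mul_cancel_left₀ (ha k).ne']
  have hsub : ∀ i t, c i '' U i t ⊆ γ := by
    rintro i t _ ⟨x, -, rfl⟩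
    rw [hγ]
    exact Set.mem_iUnion.2 ⟨i, x, rfl⟩
  have hlip : ∀ i x y, dist (c i x) (c i y) ≤ dist x y := by
    intro i x y
    have : LipschitzWith 1 (c i) := lipschitzWith_of_nnnorm_deriv_le
      ((hc i).differentiable (by norm_num)) (fun x => by
        rw [← NNReal.coe_le_coe]; simp [hd i x])
    simpa using this.dist_le_mul x y
  let ι := (Σ i : Fin J, T i) × ℤ
  let P : ι → Set E3 := fun p => coneT '' (Set.Icc (a p.2) (2 * a p.2) ×ˢ
    (g p.1.1 p.2 '' I p.1.1 p.1.2 p.2))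
  have hpiece : ∀ p : ι, (μH[2] : Measure E3).restrict (P p) ≤ (18 : ℝ≥0∞) • (coneM γ).restrict (P p) ∧
    (coneM γ).restrict (P p) ≤ (32 : ℝ≥0∞) • (μH[2] : Measure E3).restrict (P p) := by
    rintro ⟨⟨i, t, ht⟩, k⟩
    refine piece γ hγs hγm (a k) (ha k) (I i t k) ((hUc i t).image (by fun_prop)) (g i k)
      ((hc i).continuous.comp (by fun_prop)) ((hgI i t k).trans_subset (hsub i t)) ?_ ?_
    · intro x _ y _
      refine (hlip i _ _).trans ?_
      rw [Real.dist_eq, ← mul_sub, abs_mul, abs_of_pos (inv_pos.2 (ha k)), Real.dist_eq]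
    · rintro _ ⟨x, hx, rfl⟩ _ ⟨y, hy, rfl⟩
      simp only [g, inv_mul_cancel_left₀ (ha k).ne']
      rw [Real.dist_eq, ← mul_sub, abs_mul, abs_of_pos (ha k), ← Real.dist_eq]
      have := hUb i t x hx y hy
      have hak := ha k
      nlinarith
  have hPm : ∀ p, MeasurableSet (P p) := by
    rintro ⟨⟨i, t, ht⟩, k⟩
    simp only [P, hgI]
    exact ((isCompact_Icc.prod ((hUc i t).image (hc i).continuous)).image coneT_cont).measurableSet
  have hPsub : ∀ p, P p ⊆ coneOver γ := by
    rintro ⟨⟨i, t, ht⟩, k⟩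
    simp only [P, hgI]
    rintro _ ⟨⟨r, v⟩, ⟨hr, hv⟩, rfl⟩
    exact ⟨r, (ha k).trans_le hr.1, v, hsub i t hv, rfl⟩
  have hPcov : coneOver γ ⊆ ⋃ p, P p := by
    rintro _ ⟨r, hr, v, hv, rfl⟩
    rw [hγ] at hv
    obtain ⟨i, x, rfl⟩ := Set.mem_iUnion.1 hv
    have hx : x ∈ ⋃ t ∈ T i, U i t := by rw [hTU i]; trivial
    simp only [Set.mem_iUnion] at hx
    obtain ⟨t, ht, hxt⟩ := hx
    obtain ⟨k, hk⟩ := exists_mem_Ico_zpow (y := (2:ℝ)) hr (by norm_num)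
    refine Set.mem_iUnion.2 ⟨⟨⟨i, t, ht⟩, k⟩, ?_⟩
    simp only [P, hgI]
    refine ⟨(r, c i x), ⟨⟨hk.1, ?_⟩, x, hxt, rfl⟩, rfl⟩
    have := hk.2.le
    rw [zpow_add_one₀ (by norm_num)] at this
    simp only [a]
    linarith
  have hrr : ∀ p, ((μH[2] : Measure E3).restrict (coneOver γ)).restrict (P p)
      = (μH[2] : Measure E3).restrict (P p) := fun p => by
    rw [Measure.restrict_restrict (hPm p), Set.inter_eq_left.2 (hPsub p)]
  constructor
  · refine measure_le_of_cover _ _ P hPm ?_ (fun p => ?_)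
    · rw [Measure.restrict_apply (MeasurableSet.iUnion hPm).compl]
      convert measure_empty (μ := (μH[2] : Measure E3))
      rw [← Set.disjoint_iff_inter_eq_empty]
      exact (Set.disjoint_compl_left_iff_subset.2 hPcov)
    · rw [hrr, Measure.restrict_smul]
      exact (hpiece p).1
  · refine measure_le_of_cover _ _ P hPm ?_ (fun p => ?_)
    · have hae : ∀ᵐ x ∂(coneM γ), x ∈ ⋃ p, P p := by
        unfold coneM
        rw [ae_map_iff (p := fun x => x ∈ ⋃ p, P p) coneT_cont.measurable.aemeasurable
          (MeasurableSet.iUnion hPm)]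
        have q1 : ∀ᵐ r ∂radM, 0 < r := by
          have : radM ≪ volume.restrict (Set.Ioi (0:ℝ)) := withDensity_absolutelyContinuous _ _
          exact this.ae_le (ae_restrict_mem measurableSet_Ioi)
        have q2 : ∀ᵐ v ∂((μH[1] : Measure E3).restrict γ), v ∈ γ := ae_restrict_mem hγm
        filter_upwards [Measure.quasiMeasurePreserving_fst.ae q1,
          Measure.quasiMeasurePreserving_snd.ae q2] with q hq1 hq2
        exact hPcov ⟨q.1, hq1, q.2, hq2, rfl⟩
      exact ae_iff.1 hae
    · rw [Measure.restrict_smul, hrr]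
      exact (hpiece p).2

lemma lint_coneM {γ : Set E3} [IsFiniteMeasure ((μH[1] : Measure E3).restrict γ)]
    (f : E3 → ℝ≥0∞) (hf : Measurable f) :
    ∫⁻ x, f x ∂(coneM γ) = ∫⁻ v in γ, (∫⁻ r in Set.Ioi (0:ℝ), ENNReal.ofReal r * f (r • v)) ∂μH[1] := by
  unfold coneM
  rw [lintegral_map hf coneT_cont.measurable, lintegral_prod_symm (fun a => f (coneT a))
    (hf.comp coneT_cont.measurable).aemeasurable]
  congr 1
  ext v
  have hm : Measurable (fun r : ℝ => f (r • v)) := hf.comp (by fun_prop)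
  unfold radM
  rw [lintegral_withDensity_eq_lintegral_mul _ (by fun_prop)]
  · rfl
  · exact hm


instance coneM_sFinite (γ : Set E3) [IsFiniteMeasure ((μH[1] : Measure E3).restrict γ)] :
    SFinite (coneM γ) := by unfold coneM; infer_instance

lemma lhs_lower {γ : Set E3} {ν : E3 → E3} (h : IsCurveUnion γ ν)
    [IsFiniteMeasure ((μH[1] : Measure E3).restrict γ)]
    (hν : ∀ r : ℝ, 0 < r → ∀ v ∈ γ, ν (r • v) = ν v) (s : ℝ) (hs : s ∈ Set.Ioo (1/2:ℝ) 1)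
    (ζ : ℝ → ℝ) (hζm : Measurable ζ) (hζ1 : ∀ r ∈ Set.Icc 1 (Real.exp (1 / (1 - s))), ζ r = 1) :
    ENNReal.ofReal (1 / (1 - s)) * (∫⁻ x in γ, ∫⁻ y in γ,
          ENNReal.ofReal (‖ν x - ν y‖ ^ 2) * kernelK s x y ∂μH[1] ∂μH[1]) ≤
      (32 * 32) * (∫⁻ x in coneOver γ,
            (∫⁻ y in coneOver γ,
              ENNReal.ofReal (‖ν x - ν y‖ ^ 2 * ‖x - y‖ ^ (-(3:ℝ) - s)) ∂μH[2]) *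
            ENNReal.ofReal (ζ ‖x‖ ^ 2) ∂μH[2]) := by
  have hγs := curve_sphere h
  have hγm := (curve_compact h).measurableSet
  have hcm := cone_meas hγs hγm
  have hcomp := (cone_compare h).2
  obtain ⟨hs1, hs2⟩ := hs
  have h1s : 0 < 1 - s := by linarith
  set N : E3 → E3 := fun x => γ.indicator ν (‖x‖⁻¹ • x) with hN
  have hNm : Measurable N := (curve_nu_meas h).comp (by fun_prop)
  have hNr : ∀ r : ℝ, 0 < r → ∀ v ∈ γ, N (r • v) = ν v := by
    intro r hr v hv
    have hv1 : ‖v‖ = 1 := by simpa using hγs hv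
    simp only [hN]
    rw [norm_smul, hv1, mul_one, Real.norm_of_nonneg hr.le, smul_smul, inv_mul_cancel₀ hr.ne',
      one_smul, Set.indicator_of_mem hv]
  have hNν : ∀ x ∈ coneOver γ, ν x = N x := by
    rintro _ ⟨r, hr, v, hv, rfl⟩
    rw [hNr r hr v hv, hν r hr v hv]
  set F : E3 → E3 → ℝ≥0∞ := fun x y =>
    ENNReal.ofReal (‖N x - N y‖ ^ 2 * ‖x - y‖ ^ (-(3:ℝ) - s)) with hF
  have hFm : Measurable (Function.uncurry F) := by
    simp only [hF, Function.uncurry_def]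
    fun_prop
  have hFx : ∀ x, Measurable (F x) := fun x => hFm.of_uncurry_left
  set z : E3 → ℝ≥0∞ := fun x => ENNReal.ofReal (ζ ‖x‖ ^ 2) with hz
  have hzm : Measurable z := by simp only [hz]; fun_prop
  set μc := (μH[2] : Measure E3).restrict (coneOver γ) with hμc
  have hL : (∫⁻ x in coneOver γ,
            (∫⁻ y in coneOver γ,
              ENNReal.ofReal (‖ν x - ν y‖ ^ 2 * ‖x - y‖ ^ (-(3:ℝ) - s)) ∂μH[2]) *
            ENNReal.ofReal (ζ ‖x‖ ^ 2) ∂μH[2]) = ∫⁻ x, (∫⁻ y, F x y ∂μc) * z x ∂μc := by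
    refine setLIntegral_congr_fun hcm (fun x hx => ?_)
    simp only [hz]
    congr 1
    refine setLIntegral_congr_fun hcm (fun y hy => ?_)
    simp only [hF]
    rw [hNν x hx, hNν y hy]
  rw [hL]
  have hm1 : ∀ f : E3 → ℝ≥0∞, ∫⁻ x, f x ∂(coneM γ) ≤ 32 * ∫⁻ x, f x ∂μc := by
    intro f
    refine (lintegral_mono' hcomp le_rfl).trans ?_
    rw [lintegral_smul_measure, smul_eq_mul]
  have step1 : ∫⁻ x, (∫⁻ y, F x y ∂(coneM γ)) * z x ∂(coneM γ) ≤
      (32 * 32) * ∫⁻ x, (∫⁻ y, F x y ∂μc) * z x ∂μc := by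
    refine (hm1 _).trans ?_
    rw [mul_assoc]
    refine mul_le_mul_right ?_ _
    rw [← lintegral_const_mul' _ _ (by norm_num)]
    refine lintegral_mono (fun x => ?_)
    beta_reduce
    rw [← mul_assoc]
    exact mul_le_mul_left (hm1 _) _
  refine le_trans ?_ step1
  have hFy : Measurable (fun x => ∫⁻ y, F x y ∂(coneM γ)) := hFm.lintegral_prod_right'
  rw [lint_coneM (fun x => (∫⁻ y, F x y ∂(coneM γ)) * z x) (hFy.mul hzm)]
  -- inner
  set G : E3 → ℝ≥0∞ := fun v => ∫⁻ w in γ, ENNReal.ofReal (‖ν v - ν w‖ ^ 2) * kernelK s v w ∂μH[1]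
    with hG
  have hin : ∀ v ∈ γ, ∀ r : ℝ, 0 < r → ∫⁻ y, F (r • v) y ∂(coneM γ) =
      ENNReal.ofReal (r ^ (-1 - s)) * G v := by
    intro v hv r hr
    rw [lint_coneM (F (r • v)) (hFx _), hG, ← lintegral_const_mul' _ _ ENNReal.ofReal_ne_top]
    refine setLIntegral_congr_fun hγm (fun w hw => ?_)
    beta_reduce
    rw [kernelK_eq s v w (by simpa using hγs hv) (by simpa using hγs hw)]
    have := scale_lint s v w r hr (fun _ => ENNReal.ofReal (‖ν v - ν w‖ ^ 2))
    calc _ = ∫⁻ ρ in Set.Ioi (0:ℝ), ENNReal.ofReal ρ * (ENNReal.ofReal (‖ν v - ν w‖ ^ 2) *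
          ENNReal.ofReal (‖r • v - ρ • w‖ ^ (-(3:ℝ) - s))) := by
          refine setLIntegral_congr_fun measurableSet_Ioi (fun ρ hρ => ?_)
          simp only [hF]
          rw [hNr r hr v hv, hNr ρ hρ w hw, ENNReal.ofReal_mul (by positivity)]
      _ = _ := this
      _ = _ := by
          congr 1
          rw [← lintegral_const_mul' _ _ ENNReal.ofReal_ne_top]
          congr 1
          ext t
          ring
  have hIoc : ENNReal.ofReal (1 / (1 - s)) ≤
      ∫⁻ r in Set.Ioi (0:ℝ), ENNReal.ofReal (r ^ (-s)) * ENNReal.ofReal (ζ r ^ 2) := by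
    set M := Real.exp (1 / (1 - s)) with hM
    have hM1 : 1 ≤ M := Real.one_le_exp (by positivity)
    have e1 := lint_pow s M hs2 (by positivity)
    have e2 := lint_pow s 1 hs2 (by positivity)
    have hMp : M ^ (1 - s) = Real.exp 1 := by
      rw [hM, ← Real.exp_mul]; congr 1; field_simp
    rw [hMp] at e1
    rw [Real.one_rpow] at e2
    have e3 : ∫⁻ r in Set.Ioc 0 M, ENNReal.ofReal (r ^ (-s)) ≤ ENNReal.ofReal (1 / (1 - s)) +
        ∫⁻ r in Set.Ioc 1 M, ENNReal.ofReal (r ^ (-s)) := by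
      rw [← e2, ← Set.Ioc_union_Ioc_eq_Ioc (zero_le_one) hM1]
      exact lintegral_union_le _ _ _
    have e4 : ENNReal.ofReal (1 / (1 - s)) + ENNReal.ofReal (1 / (1 - s)) ≤
        ENNReal.ofReal (1 / (1 - s)) + ∫⁻ r in Set.Ioc 1 M, ENNReal.ofReal (r ^ (-s)) := by
      refine le_trans ?_ e3
      rw [e1, ← ENNReal.ofReal_add (by positivity) (by positivity)]
      apply ENNReal.ofReal_le_ofReal
      rw [← add_div]
      refine div_le_div_of_nonneg_right ?_ h1s.le
      have := Real.add_one_le_exp (1:ℝ)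
      linarith
    have e5 := (ENNReal.add_le_add_iff_left ENNReal.ofReal_ne_top).1 e4
    refine e5.trans ?_
    calc _ = ∫⁻ r in Set.Ioc 1 M, ENNReal.ofReal (r ^ (-s)) * ENNReal.ofReal (ζ r ^ 2) := by
          refine setLIntegral_congr_fun measurableSet_Ioc (fun r hr => ?_)
          beta_reduce
          rw [hζ1 r ⟨hr.1.le, hr.2⟩]
          simp
      _ ≤ _ := lintegral_mono_set (fun r hr => zero_lt_one.trans hr.1)
  rw [← lintegral_const_mul' _ _ ENNReal.ofReal_ne_top]
  refine setLIntegral_mono' hγm (fun v hv => ?_)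
  have hv1 : ‖v‖ = 1 := by simpa using hγs hv
  calc ENNReal.ofReal (1 / (1 - s)) * G v
      ≤ (∫⁻ r in Set.Ioi (0:ℝ), ENNReal.ofReal (r ^ (-s)) * ENNReal.ofReal (ζ r ^ 2)) * G v :=
        mul_le_mul_left hIoc _
    _ = ∫⁻ r in Set.Ioi (0:ℝ), ENNReal.ofReal (r ^ (-s)) * ENNReal.ofReal (ζ r ^ 2) * G v := by
        rw [lintegral_mul_const _ (by fun_prop)]
    _ = _ := by
        refine setLIntegral_congr_fun measurableSet_Ioi (fun r hr => ?_)
        have hr : 0 < r := hr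
        simp only [hz]
        rw [hin v hv r hr, norm_smul, hv1, mul_one, Real.norm_of_nonneg hr.le]
        have : ENNReal.ofReal (r ^ (-s)) = ENNReal.ofReal r * ENNReal.ofReal (r ^ (-1 - s)) := by
          rw [← ENNReal.ofReal_mul hr.le]
          congr 1
          rw [show -s = 1 + (-1 - s) by ring, Real.rpow_add hr, Real.rpow_one]
        rw [this]
        ring

set_option maxHeartbeats 400000 in
lemma rhs_upper {γ : Set E3} {ν : E3 → E3} (h : IsCurveUnion γ ν)
    [IsFiniteMeasure ((μH[1] : Measure E3).restrict γ)]
    (s : ℝ) (hs : s ∈ Set.Ioo (1/2:ℝ) 1) (D K : ℝ) (hD : 0 ≤ D) (hK : 0 ≤ K)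
    (hdens : ∀ v ∈ γ, ∀ u, 0 < u → (μH[1] : Measure E3).restrict γ (Metric.ball v u)
      ≤ ENNReal.ofReal (D * u))
    (ζ : ℝ → ℝ) (hζm : Measurable ζ) (hζ0 : ∀ r, Real.exp (2 / (1 - s)) < r → ζ r = 0)
    (hζL : ∀ r ρ, 0 < r → 0 < ρ →
      (ζ r - ζ ρ) ^ 2 ≤ K * (1 - s) ^ 2 * (Real.log (ρ / r)) ^ 2) :
    (∫⁻ x in coneOver γ, ∫⁻ y in coneOver γ,
       ENNReal.ofReal ((ζ ‖x‖ - ζ ‖y‖) ^ 2 * ‖x - y‖ ^ (-(3:ℝ) - s)) ∂μH[2] ∂μH[2])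
      ≤ (18 * 18) * (2 * (ENNReal.ofReal (K * (1 - s) ^ 2 * (576 * D / (1 - s)) *
          (Real.exp 2 / (1 - s))) * μH[1] γ)) := by
  have hγs := curve_sphere h
  have hγm := (curve_compact h).measurableSet
  have hcm := cone_meas hγs hγm
  have hcomp := (cone_compare h).1
  have hs' := hs
  obtain ⟨hs1, hs2⟩ := hs
  have h1s : 0 < 1 - s := by linarith
  set M := Real.exp (2 / (1 - s)) with hM
  have hM0 : 0 < M := Real.exp_pos _
  set H : E3 → E3 → ℝ≥0∞ := fun x y =>
    ENNReal.ofReal (K * (1 - s) ^ 2 * (Real.log (‖y‖ / ‖x‖)) ^ 2) *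
      ENNReal.ofReal (‖x - y‖ ^ (-(3:ℝ) - s)) with hH
  have hHm : Measurable (Function.uncurry H) := by
    simp only [hH, Function.uncurry_def]
    fun_prop
  have hHxm : ∀ x, Measurable (H x) := fun x => hHm.of_uncurry_left
  have hHsymm : ∀ x y, H x y = H y x := by
    intro x y
    simp only [hH]
    rw [norm_sub_rev x y, ← inv_div ‖x‖ ‖y‖, Real.log_inv, neg_sq]
  set χ : E3 → ℝ≥0∞ := Set.indicator {x : E3 | ‖x‖ ≤ M} (fun _ => 1) with hχ
  have hχm : Measurable χ := measurable_const.indicator (measurableSet_le (by fun_prop) (by fun_prop))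
  have hm1 : ∀ f : E3 → ℝ≥0∞, ∫⁻ x, f x ∂((μH[2] : Measure E3).restrict (coneOver γ))
      ≤ 18 * ∫⁻ x, f x ∂(coneM γ) := by
    intro f
    refine (lintegral_mono' hcomp le_rfl).trans ?_
    rw [lintegral_smul_measure, smul_eq_mul]
  have hpos : ∀ x ∈ coneOver γ, 0 < ‖x‖ := fun x hx => norm_pos_iff.2 ((mem_cone_iff hγs x).1 hx).1
  have hpt : ∀ x ∈ coneOver γ, ∀ y ∈ coneOver γ,
      ENNReal.ofReal ((ζ ‖x‖ - ζ ‖y‖) ^ 2 * ‖x - y‖ ^ (-(3:ℝ) - s)) ≤ χ x * H x y + χ y * H x y := by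
    intro x hx y hy
    have hxH : ENNReal.ofReal ((ζ ‖x‖ - ζ ‖y‖) ^ 2 * ‖x - y‖ ^ (-(3:ℝ) - s)) ≤ H x y := by
      simp only [hH]
      rw [← ENNReal.ofReal_mul (by positivity)]
      exact ENNReal.ofReal_le_ofReal (mul_le_mul_of_nonneg_right
        (hζL _ _ (hpos x hx) (hpos y hy)) (by positivity))
    by_cases h1 : ‖x‖ ≤ M
    · have : χ x = 1 := Set.indicator_of_mem (show x ∈ {x : E3 | ‖x‖ ≤ M} from h1) _
      rw [this, one_mul]
      exact hxH.trans le_self_add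
    · by_cases h2 : ‖y‖ ≤ M
      · have : χ y = 1 := Set.indicator_of_mem (show y ∈ {x : E3 | ‖x‖ ≤ M} from h2) _
        rw [this, one_mul]
        exact hxH.trans le_add_self
      · rw [hζ0 _ (not_le.1 h1), hζ0 _ (not_le.1 h2)]
        simp
  set B := ENNReal.ofReal (K * (1 - s) ^ 2 * (576 * D / (1 - s))) with hB
  have hin : ∀ v ∈ γ, ∀ r : ℝ, 0 < r → ∫⁻ y, H (r • v) y ∂(coneM γ) ≤
      ENNReal.ofReal (r ^ (-1 - s)) * B := by
    intro v hv r hr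
    have hv1 : ‖v‖ = 1 := by simpa using hγs hv
    have hna : NullSingletonClass (μH[1] : Measure E3) :=
      Measure.nullSingletonClass_hausdorff E3 (by norm_num)
    have hne : ∀ᵐ w ∂((μH[1] : Measure E3).restrict γ), v ≠ w := by
      refine ae_restrict_of_ae ?_
      rw [ae_iff]
      simp
    have hfar : ∀ᵐ w ∂((μH[1] : Measure E3).restrict γ), dist v w ≤ 2 := by
      filter_upwards [ae_restrict_mem hγm] with w hw
      have hw1 : ‖w‖ = 1 := by simpa using hγs hw
      rw [dist_eq_norm]
      refine (norm_sub_le _ _).trans ?_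
      rw [hv1, hw1]; norm_num
    have hR := riesz_bound ((μH[1] : Measure E3).restrict γ) s D hs' hD v hfar hne (hdens v hv)
    rw [lint_coneM (H (r • v)) (hHxm _)]
    calc _ ≤ ∫⁻ w in γ, ENNReal.ofReal (r ^ (-1 - s)) * (ENNReal.ofReal (K * (1 - s) ^ 2) *
          (ENNReal.ofReal 36 * ENNReal.ofReal (dist v w ^ (-s)))) ∂μH[1] := by
          refine lintegral_mono_ae ?_
          filter_upwards [hne, ae_restrict_mem hγm] with w hvw hw
          have hw1 : ‖w‖ = 1 := by simpa using hγs hw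
          have hsc := scale_lint s v w r hr (fun t => ENNReal.ofReal (K * (1 - s) ^ 2) *
            ENNReal.ofReal (Real.log t ^ 2))
          calc _ = ∫⁻ ρ in Set.Ioi (0:ℝ), ENNReal.ofReal ρ *
                (ENNReal.ofReal (K * (1 - s) ^ 2) * ENNReal.ofReal (Real.log (ρ / r) ^ 2) *
                  ENNReal.ofReal (‖r • v - ρ • w‖ ^ (-(3:ℝ) - s))) := by
                refine setLIntegral_congr_fun measurableSet_Ioi (fun ρ hρ => ?_)
                have hρ : 0 < ρ := hρ
                simp only [hH]
                rw [norm_smul, norm_smul, hv1, hw1, mul_one, mul_one, Real.norm_of_nonneg hr.le,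
                  Real.norm_of_nonneg hρ.le, ENNReal.ofReal_mul (p := K * (1 - s) ^ 2) (by positivity)]
            _ = _ := hsc
            _ = ENNReal.ofReal (r ^ (-1 - s)) * (ENNReal.ofReal (K * (1 - s) ^ 2) *
                ∫⁻ t in Set.Ioi (0:ℝ), ENNReal.ofReal t *
        (ENNReal.ofReal ((Real.log t) ^ 2) * ENNReal.ofReal (‖v - t • w‖ ^ (-(3:ℝ) - s)))) := by
                congr 1
                rw [← lintegral_const_mul' _ _ ENNReal.ofReal_ne_top]
                congr 1
                ext t
                ring
            _ ≤ _ := by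
                refine mul_le_mul_right (mul_le_mul_right ?_ _) _
                exact Q_bound s hs' v w hv1 hw1 hvw
      _ = ENNReal.ofReal (r ^ (-1 - s)) * (ENNReal.ofReal (K * (1 - s) ^ 2) *
          (ENNReal.ofReal 36 * ∫⁻ w in γ, ENNReal.ofReal (dist v w ^ (-s)) ∂μH[1])) := by
          rw [lintegral_const_mul' _ _ ENNReal.ofReal_ne_top,
            lintegral_const_mul' _ _ ENNReal.ofReal_ne_top,
            lintegral_const_mul' _ _ ENNReal.ofReal_ne_top]
      _ ≤ ENNReal.ofReal (r ^ (-1 - s)) * (ENNReal.ofReal (K * (1 - s) ^ 2) *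
          (ENNReal.ofReal 36 * ENNReal.ofReal (16 * D / (1 - s)))) :=
          mul_le_mul_right (mul_le_mul_right (mul_le_mul_right hR _) _) _
      _ = _ := by
          congr 1
          rw [hB, ← ENNReal.ofReal_mul (by norm_num), ← ENNReal.ofReal_mul (by positivity)]
          congr 1
          ring
  have hHx : Measurable (fun x => ∫⁻ y, H x y ∂(coneM γ)) := hHm.lintegral_prod_right'
  have main1 : ∫⁻ x, χ x * ∫⁻ y, H x y ∂(coneM γ) ∂(coneM γ) ≤
      B * ENNReal.ofReal (Real.exp 2 / (1 - s)) * μH[1] γ := by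
    rw [lint_coneM (fun x => χ x * ∫⁻ y, H x y ∂(coneM γ)) (hχm.mul hHx)]
    calc _ ≤ ∫⁻ v in γ, B * ENNReal.ofReal (Real.exp 2 / (1 - s)) ∂μH[1] := by
          refine setLIntegral_mono' hγm (fun v hv => ?_)
          have hv1 : ‖v‖ = 1 := by simpa using hγs hv
          have hMp : M ^ (1 - s) = Real.exp 2 := by
            rw [hM, ← Real.exp_mul]; congr 1; field_simp
          rw [← hMp, ← lint_pow s M hs2 hM0.le, ← lintegral_const_mul' _ _ (by rw [hB]; exact ENNReal.ofReal_ne_top),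
            ← Set.inter_eq_left.2 (show Set.Ioc 0 M ⊆ Set.Ioi 0 from fun r hr => hr.1),
            ← Measure.restrict_restrict measurableSet_Ioc, ← lintegral_indicator measurableSet_Ioc]
          refine setLIntegral_mono' measurableSet_Ioi (fun r hr => ?_)
          have hr : 0 < r := hr
          have hnr : ‖r • v‖ = r := by rw [norm_smul, hv1, mul_one, Real.norm_of_nonneg hr.le]
          beta_reduce
          by_cases hrM : r ≤ M
          · rw [Set.indicator_of_mem (show r ∈ Set.Ioc 0 M from ⟨hr, hrM⟩)]
            have : χ (r • v) = 1 := Set.indicator_of_mem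
              (show r • v ∈ {x : E3 | ‖x‖ ≤ M} from hnr.trans_le hrM) _
            rw [this, one_mul]
            refine (mul_le_mul_right (hin v hv r hr) _).trans (le_of_eq ?_)
            have : ENNReal.ofReal (r ^ (-s)) = ENNReal.ofReal r * ENNReal.ofReal (r ^ (-1 - s)) := by
              rw [← ENNReal.ofReal_mul hr.le]
              congr 1
              rw [show -s = 1 + (-1 - s) by ring, Real.rpow_add hr, Real.rpow_one]
            rw [this]
            ring
          · have : χ (r • v) = 0 := Set.indicator_of_notMem
              (show r • v ∉ {x : E3 | ‖x‖ ≤ M} from fun hc => hrM (hnr.symm.trans_le hc)) _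
            rw [this]
            simp
      _ = _ := by rw [setLIntegral_const]
  calc _ ≤ ∫⁻ x in coneOver γ, (∫⁻ y in coneOver γ, (χ x * H x y + χ y * H x y) ∂μH[2]) ∂μH[2] :=
        setLIntegral_mono' hcm (fun x hx => setLIntegral_mono' hcm (fun y hy => hpt x hx y hy))
    _ ≤ 18 * ∫⁻ x, (∫⁻ y in coneOver γ, (χ x * H x y + χ y * H x y) ∂μH[2]) ∂(coneM γ) := hm1 _
    _ ≤ 18 * ∫⁻ x, 18 * (∫⁻ y, (χ x * H x y + χ y * H x y) ∂(coneM γ)) ∂(coneM γ) :=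
        mul_le_mul_right (lintegral_mono (fun x => hm1 _)) _
    _ = (18 * 18) * ∫⁻ x, (∫⁻ y, (χ x * H x y + χ y * H x y) ∂(coneM γ)) ∂(coneM γ) := by
        rw [lintegral_const_mul' _ _ (by norm_num), mul_assoc]
    _ = (18 * 18) * (2 * ∫⁻ x, χ x * ∫⁻ y, H x y ∂(coneM γ) ∂(coneM γ)) := by
        congr 1
        have f1 : ∀ x, ∫⁻ y, (χ x * H x y + χ y * H x y) ∂(coneM γ) =
            χ x * ∫⁻ y, H x y ∂(coneM γ) + ∫⁻ y, χ y * H x y ∂(coneM γ) := by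
          intro x
          rw [lintegral_add_left ((hHxm x).const_mul _), lintegral_const_mul _ (hHxm x)]
        simp only [f1]
        have hmm : Measurable (fun x => χ x * ∫⁻ y, H x y ∂(coneM γ)) := hχm.mul hHx
        rw [lintegral_add_left hmm, two_mul]
        congr 1
        have hχH : Measurable (Function.uncurry (fun x y => χ y * H x y)) :=
          (hχm.comp measurable_snd).mul hHm
        rw [lintegral_lintegral_swap hχH.aemeasurable]
        congr 1
        ext y
        rw [← lintegral_const_mul _ (hHxm y)]
        congr 1
        ext x
        rw [hHsymm x y]
    _ ≤ (18 * 18) * (2 * (B * ENNReal.ofReal (Real.exp 2 / (1 - s)) * μH[1] γ)) :=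
        mul_le_mul_right (mul_le_mul_right main1 _) _
    _ = _ := by
        rw [hB, ← ENNReal.ofReal_mul (by positivity)]


/-- for every `C₁ > 0` there is `C = C(C₁)` such that for every
`s ∈ (1/2,1)`, every stable cone over a union of curves `γ ⊂ S²` satisfying the density
bound `H¹(γ ∩ B_ρ(p)) ≤ C₁ ρ/(1−s)` satisfies the key integral estimate
`∬_{γ×γ} |ν(x̂)−ν(ŷ)|² k_s(x̂,ŷ) dH¹ dH¹ ≤ C H¹(γ)`. -/
theorem nonlocal_second_fundamental_form_bound (C₁ : ℝ) (hC₁ : 0 < C₁) :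
    ∃ C : ℝ, 0 < C ∧ ∀ s ∈ Set.Ioo (1/2 : ℝ) 1,
      ∀ (γ : Set E3) (ν : E3 → E3), IsCurveUnion γ ν →
      (∀ r : ℝ, 0 < r → ∀ v ∈ γ, ν (r • v) = ν v) →
      (∀ ζ : ℝ → ℝ, ContDiff ℝ 2 ζ → HasCompactSupport ζ → tsupport ζ ⊆ Set.Ioi (0:ℝ) →
        (∫⁻ x in coneOver γ,
            (∫⁻ y in coneOver γ,
              ENNReal.ofReal (‖ν x - ν y‖ ^ 2 * ‖x - y‖ ^ (-(3:ℝ) - s)) ∂μH[2]) *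
            ENNReal.ofReal (ζ ‖x‖ ^ 2) ∂μH[2])
          ≤ ∫⁻ x in coneOver γ, ∫⁻ y in coneOver γ,
              ENNReal.ofReal ((ζ ‖x‖ - ζ ‖y‖) ^ 2 * ‖x - y‖ ^ (-(3:ℝ) - s)) ∂μH[2] ∂μH[2]) →
      (∀ p ∈ γ, ∀ ρ ∈ Set.Ioo (0:ℝ) (1/2),
        μH[1] (γ ∩ Metric.ball p ρ) ≤ ENNReal.ofReal (C₁ * ρ / (1 - s))) →
      (∫⁻ x in γ, ∫⁻ y in γ,
          ENNReal.ofReal (‖ν x - ν y‖ ^ 2) * kernelK s x y ∂μH[1] ∂μH[1])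
        ≤ ENNReal.ofReal C * μH[1] γ := by
  obtain ⟨N, hN⟩ := cover_bound
  obtain ⟨K, hK, hζ⟩ := exists_zeta
  refine ⟨1024 * 324 * 2 * K * 576 * ((N + 1) * C₁) * Real.exp 2, by positivity, ?_⟩
  intro s hs γ ν h hν hstab hdens
  have hγs := curve_sphere h
  have h1s : 0 < 1 - s := by linarith [hs.2]
  have htot : μH[1] γ ≤ N * ENNReal.ofReal (C₁ * (1/4) / (1 - s)) :=
    hN γ hγs _ _ (fun p hp => hdens p hp (1/4) (by norm_num))
  have hfin : IsFiniteMeasure ((μH[1] : Measure E3).restrict γ) := by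
    refine ⟨?_⟩
    rw [Measure.restrict_apply_univ]
    exact htot.trans_lt (ENNReal.mul_lt_top (by simp) ENNReal.ofReal_lt_top)
  obtain ⟨ζ, hζc, hζs, hζt, hζ1, hζ0, hζL⟩ := hζ (1 - s) h1s
  have hζm : Measurable ζ := hζc.continuous.measurable
  have hD : ∀ v ∈ γ, ∀ u, 0 < u → (μH[1] : Measure E3).restrict γ (Metric.ball v u)
      ≤ ENNReal.ofReal (((N + 1) * C₁ / (1 - s)) * u) := by
    intro v hv u hu
    rw [Measure.restrict_apply measurableSet_ball, Set.inter_comm]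
    rcases lt_or_ge u (1/2) with h2 | h2
    · refine (hdens v hv u ⟨hu, h2⟩).trans (ENNReal.ofReal_le_ofReal ?_)
      rw [div_mul_eq_mul_div]
      refine div_le_div_of_nonneg_right ?_ h1s.le
      have : 0 ≤ (N:ℝ) * C₁ * u := by positivity
      nlinarith
    · refine (measure_mono Set.inter_subset_left).trans (htot.trans ?_)
      rw [← ENNReal.ofReal_natCast, ← ENNReal.ofReal_mul (by positivity)]
      apply ENNReal.ofReal_le_ofReal
      rw [div_mul_eq_mul_div, ← mul_div_assoc]
      refine div_le_div_of_nonneg_right ?_ h1s.le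
      have : 0 ≤ (N:ℝ) * C₁ := by positivity
      nlinarith
  have hL := lhs_lower h hν s hs ζ hζm hζ1
  have hR := rhs_upper h s hs ((N + 1) * C₁ / (1 - s)) K (by positivity) hK.le hD ζ hζm hζ0 hζL
  have hS := hstab ζ hζc hζs hζt
  have hall := (hL.trans (mul_le_mul_right hS _)).trans (mul_le_mul_right hR _)
  have hfinal := mul_le_mul_right hall (ENNReal.ofReal (1 - s))
  rw [← mul_assoc, ← ENNReal.ofReal_mul h1s.le, mul_one_div_cancel h1s.ne', ENNReal.ofReal_one,
    one_mul] at hfinal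
  refine hfinal.trans (le_of_eq ?_)
  have c1 : (32 * 32 : ℝ≥0∞) = ENNReal.ofReal 1024 := by norm_num
  have c2 : (18 * 18 : ℝ≥0∞) = ENNReal.ofReal 324 := by norm_num
  have c3 : (2 : ℝ≥0∞) = ENNReal.ofReal 2 := by norm_num
  generalize (μH[1] γ : ℝ≥0∞) = A
  rw [c1, c2, c3]
  simp only [← mul_assoc]
  rw [← ENNReal.ofReal_mul h1s.le, ← ENNReal.ofReal_mul (by positivity),
    ← ENNReal.ofReal_mul (by positivity), ← ENNReal.ofReal_mul (by positivity)]
  congr 2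
  field_simp
end
end

section
/- There exists a universal constant C such that for every σ ∈ [3/4,1) and every continuous function f : I → ℝ, where I = [0,5π], the following holds. Setting f̄ := (1/(5π)) ∫_I f(t) dt and [f]_{H^σ(I)} := ((1−σ) ∬_{I×I} |f(t)−f(t̄)|² |t−t̄|^{−1−2σ} dt dt̄)^{1/2}, one has sup_{t∈I} |f(t)−f̄| ≤ C [f]_{H^σ(I)} and |f(t)−f(t̄)| ≤ C [f]_{H^σ(I)} |t−t̄|^{1/4} for all t, t̄ ∈ I. In particular, the C^{1/4}(I) norm of f − f̄ is bounded by C [f]_{H^σ(I)}. -/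
open MeasureTheory
open scoped ENNReal

noncomputable section

/-- The (Bourgain–Brezis–Mironescu normalized) `H^σ` seminorm of `f` on `I = [0,5π]`,
`[f]_{H^σ(I)} = ((1−σ) ∬_{I×I} |f(t)−f(t̄)|² |t−t̄|^{−1−2σ} dt dt̄)^{1/2}`, valued in `[0,∞]`. -/
def Hseminorm (σ : ℝ) (f : ℝ → ℝ) : ℝ≥0∞ :=
  (ENNReal.ofReal (1 - σ) *
    ∫⁻ t in Set.Icc 0 (5 * Real.pi), ∫⁻ u in Set.Icc 0 (5 * Real.pi),
      ENNReal.ofReal ((f t - f u) ^ 2 * |t - u| ^ (-(1:ℝ) - 2 * σ))) ^ (1/2 : ℝ)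


/-- The truncated kernel on `[a,b]`, near the diagonal. -/
def nearW (σ : ℝ) (f : ℝ → ℝ) (a b r : ℝ) (t u : ℝ) : ℝ≥0∞ :=
  {p : ℝ × ℝ | p.1 ∈ Set.Icc a b ∧ p.2 ∈ Set.Icc a b ∧ |p.1 - p.2| ≤ r}.indicator
    (fun p => ENNReal.ofReal ((f p.1 - f p.2) ^ 2 * |p.1 - p.2| ^ (-(1:ℝ) - 2 * σ))) (t, u)

/-- The truncated kernel on `[a,b]`, away from the diagonal. -/
def farW (σ : ℝ) (f : ℝ → ℝ) (a b r : ℝ) (t u : ℝ) : ℝ≥0∞ :=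
  {p : ℝ × ℝ | p.1 ∈ Set.Icc a b ∧ p.2 ∈ Set.Icc a b ∧ r < |p.1 - p.2|}.indicator
    (fun p => ENNReal.ofReal ((f p.1 - f p.2) ^ 2 * |p.1 - p.2| ^ (-(1:ℝ) - 2 * σ))) (t, u)

/-- Energy near the diagonal. -/
def nearQ (σ : ℝ) (f : ℝ → ℝ) (a b r : ℝ) : ℝ≥0∞ := ∫⁻ t, ∫⁻ u, nearW σ f a b r t u

/-- Energy away from the diagonal. -/
def farQ (σ : ℝ) (f : ℝ → ℝ) (a b r : ℝ) : ℝ≥0∞ := ∫⁻ t, ∫⁻ u, farW σ f a b r t u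

lemma kernel_measurable (σ : ℝ) {f : ℝ → ℝ} (hf : Continuous f) :
    Measurable (fun p : ℝ × ℝ =>
      ENNReal.ofReal ((f p.1 - f p.2) ^ 2 * |p.1 - p.2| ^ (-(1:ℝ) - 2 * σ))) := by
  have h1 : Measurable f := hf.measurable
  fun_prop

lemma nearW_measurable (σ : ℝ) {f : ℝ → ℝ} (hf : Continuous f) (a b r : ℝ) :
    Measurable (fun p : ℝ × ℝ => nearW σ f a b r p.1 p.2) := by
  unfold nearW
  refine (kernel_measurable σ hf).indicator ?_
  refine (measurable_fst measurableSet_Icc).inter ((measurable_snd measurableSet_Icc).inter ?_)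
  exact measurableSet_le (f := fun p : ℝ × ℝ => |p.1 - p.2|) (g := fun _ => r)
    (by fun_prop) (by fun_prop)

lemma farW_measurable (σ : ℝ) {f : ℝ → ℝ} (hf : Continuous f) (a b r : ℝ) :
    Measurable (fun p : ℝ × ℝ => farW σ f a b r p.1 p.2) := by
  unfold farW
  refine (kernel_measurable σ hf).indicator ?_
  refine (measurable_fst measurableSet_Icc).inter ((measurable_snd measurableSet_Icc).inter ?_)
  exact measurableSet_lt (f := fun _ : ℝ × ℝ => r) (g := fun p : ℝ × ℝ => |p.1 - p.2|)
    (by fun_prop) (by fun_prop)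

lemma lintegral_mid {g : ℝ → ℝ≥0∞} (hg : Measurable g) (t : ℝ) :
    ∫⁻ u, g ((t + u) / 2) = 2 * ∫⁻ u, g u := by
  rw [lintegral_add_left_eq_self (fun u => g (u / 2)) t]
  have h := Real.map_volume_mul_left (a := (1/2 : ℝ)) (by norm_num)
  have h2 : ∫⁻ u, g u ∂(Measure.map ((1/2 : ℝ) * ·) volume) = ∫⁻ u, g ((1/2) * u) :=
    lintegral_map hg (by fun_prop)
  rw [h, lintegral_smul_measure] at h2
  have h3 : ENNReal.ofReal |((1/2 : ℝ))⁻¹| = 2 := by norm_num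
  rw [h3, smul_eq_mul] at h2
  rw [h2]
  congr 1; ext u; congr 1; ring

lemma nearW_mid (σ : ℝ) (f : ℝ → ℝ) (a b r t u : ℝ) :
    nearW σ f a b (2 * r) t u ≤ ENNReal.ofReal (2 ^ (-(2:ℝ) * σ)) *
      (nearW σ f a b r t ((t + u) / 2) + nearW σ f a b r ((t + u) / 2) u) := by
  by_cases h : t ∈ Set.Icc a b ∧ u ∈ Set.Icc a b ∧ |t - u| ≤ 2 * r
  · obtain ⟨ht, hu, hr⟩ := h
    have hm : (t + u) / 2 ∈ Set.Icc a b := by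
      constructor <;> [linarith [ht.1, hu.1]; linarith [ht.2, hu.2]]
    have e1 : |t - (t + u) / 2| = |t - u| / 2 := by
      rw [show t - (t + u) / 2 = (t - u) / 2 by ring, abs_div]; norm_num
    have e2 : |(t + u) / 2 - u| = |t - u| / 2 := by
      rw [show (t + u) / 2 - u = (t - u) / 2 by ring, abs_div]; norm_num
    unfold nearW
    rw [Set.indicator_of_mem (by exact ⟨ht, hu, hr⟩), Set.indicator_of_mem (by
        refine ⟨ht, hm, ?_⟩; simp only [e1]; linarith), Set.indicator_of_mem (by
        refine ⟨hm, hu, ?_⟩; simp only [e2]; linarith)]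
    simp only [e1, e2]
    rw [← ENNReal.ofReal_add (by positivity) (by positivity),
      ← ENNReal.ofReal_mul (by positivity)]
    apply ENNReal.ofReal_le_ofReal
    have e3 : |t - u| ^ (-(1:ℝ) - 2 * σ) =
        2 ^ (-(1:ℝ) - 2 * σ) * (|t - u| / 2) ^ (-(1:ℝ) - 2 * σ) := by
      rw [← Real.mul_rpow (by norm_num) (by positivity)]; congr 1; ring
    have e4 : (2:ℝ) ^ (-(2:ℝ) * σ) = 2 * 2 ^ (-(1:ℝ) - 2 * σ) := by
      rw [show -(2:ℝ) * σ = 1 + (-(1:ℝ) - 2 * σ) by ring, Real.rpow_add (by norm_num),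
        Real.rpow_one]
    rw [e3, e4]
    set z := (|t - u| / 2) ^ (-(1:ℝ) - 2 * σ)
    have hz : 0 ≤ z := by positivity
    set w := (2:ℝ) ^ (-(1:ℝ) - 2 * σ)
    have hw : 0 ≤ w := by positivity
    have : (f t - f u) ^ 2 ≤ 2 * ((f t - f ((t+u)/2)) ^ 2 + (f ((t+u)/2) - f u) ^ 2) := by
      nlinarith [sq_nonneg ((f t - f ((t+u)/2)) - (f ((t+u)/2) - f u))]
    have := mul_le_mul_of_nonneg_right this (mul_nonneg hw hz)
    linarith
  · unfold nearW
    rw [Set.indicator_of_notMem (by exact h)]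
    exact zero_le

lemma nearQ_scale (σ : ℝ) {f : ℝ → ℝ} (hf : Continuous f) (a b r : ℝ) :
    nearQ σ f a b (2 * r) ≤ ENNReal.ofReal (2 ^ (2 - 2 * σ)) * nearQ σ f a b r := by
  have hm := nearW_measurable σ hf a b r
  have hm1 : ∀ t, Measurable (fun u => nearW σ f a b r t u) := fun t =>
    hm.comp (measurable_const.prodMk measurable_id)
  have hm2 : ∀ u, Measurable (fun t => nearW σ f a b r t u) := fun u =>
    hm.comp (measurable_id.prodMk measurable_const)
  have hA : Measurable (fun p : ℝ × ℝ => nearW σ f a b r p.1 ((p.1 + p.2) / 2)) :=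
    hm.comp (measurable_fst.prodMk (by fun_prop : Measurable fun p : ℝ × ℝ => (p.1 + p.2) / 2))
  have hB : Measurable (fun p : ℝ × ℝ => nearW σ f a b r ((p.1 + p.2) / 2) p.2) :=
    hm.comp ((by fun_prop : Measurable fun p : ℝ × ℝ => (p.1 + p.2) / 2).prodMk measurable_snd)
  have h1 : ∫⁻ t, ∫⁻ u, nearW σ f a b r t ((t + u) / 2) = 2 * nearQ σ f a b r := by
    unfold nearQ
    rw [← lintegral_const_mul _ (Measurable.lintegral_prod_right' hm)]
    congr 1; ext t
    exact lintegral_mid (hm1 t) t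
  have h2 : ∫⁻ t, ∫⁻ u, nearW σ f a b r ((t + u) / 2) u = 2 * nearQ σ f a b r := by
    unfold nearQ
    rw [lintegral_lintegral_swap hB.aemeasurable,
      lintegral_lintegral_swap (f := fun t u => nearW σ f a b r t u) hm.aemeasurable]
    rw [← lintegral_const_mul _ (Measurable.lintegral_prod_left' hm)]
    congr 1; ext u
    rw [← lintegral_mid (hm2 u) u]
    congr 1; ext t; rw [add_comm]
  calc nearQ σ f a b (2 * r) ≤ ∫⁻ t, ∫⁻ u, ENNReal.ofReal (2 ^ (-(2:ℝ) * σ)) *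
      (nearW σ f a b r t ((t + u) / 2) + nearW σ f a b r ((t + u) / 2) u) :=
        lintegral_mono fun t => lintegral_mono fun u => nearW_mid σ f a b r t u
    _ = ENNReal.ofReal (2 ^ (-(2:ℝ) * σ)) * (∫⁻ t, ∫⁻ u,
      (nearW σ f a b r t ((t + u) / 2) + nearW σ f a b r ((t + u) / 2) u)) := by
        rw [← lintegral_const_mul' _ _ ENNReal.ofReal_ne_top]
        congr 1; ext t
        rw [lintegral_const_mul' _ _ ENNReal.ofReal_ne_top]
    _ = ENNReal.ofReal (2 ^ (-(2:ℝ) * σ)) * (2 * nearQ σ f a b r + 2 * nearQ σ f a b r) := by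
        rw [← h1]; nth_rewrite 2 [h1]; rw [← h2, ← lintegral_add_left
          (Measurable.lintegral_prod_right' hA)]
        congr 2; ext t
        rw [lintegral_add_left]
        exact hA.comp (measurable_const.prodMk measurable_id)
    _ = ENNReal.ofReal (2 ^ (2 - 2 * σ)) * nearQ σ f a b r := by
        have : (2:ℝ) ^ (2 - 2 * σ) = 2 ^ (-(2:ℝ) * σ) * 4 := by
          rw [show 2 - 2 * σ = -(2:ℝ) * σ + 2 by ring, Real.rpow_add (by norm_num)]
          norm_num
        rw [this, ENNReal.ofReal_mul (by positivity)]
        have : ENNReal.ofReal 4 = 2 + 2 := by norm_num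
        rw [this]; ring

lemma near_add_far (σ : ℝ) {f : ℝ → ℝ} (hf : Continuous f) (a b r : ℝ) :
    nearQ σ f a b (b - a) = nearQ σ f a b r + farQ σ f a b r ∨ b - a < r := by
  by_cases hr : b - a < r
  · exact Or.inr hr
  left
  push Not at hr
  have hm := nearW_measurable σ hf a b r
  unfold nearQ farQ
  rw [← lintegral_add_left (Measurable.lintegral_prod_right' hm)]
  congr 1; ext t
  have hmt : Measurable (fun u => nearW σ f a b r t u) :=
    hm.comp (measurable_const.prodMk measurable_id)
  rw [← lintegral_add_left hmt]
  congr 1; ext u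
  simp only [nearW, farW, Set.indicator_apply, Set.mem_ofPred_eq]
  by_cases ht : t ∈ Set.Icc a b
  · by_cases hu : u ∈ Set.Icc a b
    · have : |t - u| ≤ b - a := by
        rw [abs_le]; constructor <;> linarith [ht.1, ht.2, hu.1, hu.2]
      by_cases h : |t - u| ≤ r
      · simp [ht, hu, this, h, not_lt.mpr h]
      · simp [ht, hu, this, h, not_le.mp h]
    · simp [hu]
  · simp [ht]

lemma farQ_le {σ : ℝ} (hσ : σ < 1) {f : ℝ → ℝ} (hf : Continuous f) {a b : ℝ} (hab : a < b)
    (hfin : nearQ σ f a b (b - a) ≠ ⊤) :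
    farQ σ f a b ((b - a) / 4) ≤ ENNReal.ofReal (4 * (1 - σ)) * nearQ σ f a b (b - a) := by
  have h1 := nearQ_scale σ hf a b ((b - a) / 2)
  have h2 := nearQ_scale σ hf a b ((b - a) / 4)
  rw [show 2 * ((b - a) / 2) = b - a by ring] at h1
  rw [show 2 * ((b - a) / 4) = (b - a) / 2 by ring] at h2
  have h3 := (near_add_far σ hf a b ((b - a) / 4)).resolve_right (by linarith)
  set q := nearQ σ f a b (b - a)
  set q2 := nearQ σ f a b ((b - a) / 4)
  set v := farQ σ f a b ((b - a) / 4)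
  have h4 : q ≤ ENNReal.ofReal (2 ^ (4 - 4 * σ)) * q2 := by
    refine (h1.trans (mul_le_mul_right h2 _)).trans_eq ?_
    rw [← mul_assoc, ← ENNReal.ofReal_mul (by positivity), ← Real.rpow_add (by norm_num)]
    congr 3; ring
  have hq2 : q2 ≠ ⊤ := fun h => hfin (by rw [h3, h]; simp)
  have hv : v ≠ ⊤ := fun h => hfin (by rw [h3, h]; simp)
  have h4' := ENNReal.toReal_mono (ENNReal.mul_ne_top ENNReal.ofReal_ne_top hq2) h4
  rw [ENNReal.toReal_mul, ENNReal.toReal_ofReal (by positivity)] at h4'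
  have h3' : q.toReal = q2.toReal + v.toReal := by rw [h3, ENNReal.toReal_add hq2 hv]
  rw [← ENNReal.ofReal_toReal hv, ← ENNReal.ofReal_toReal hfin,
    ← ENNReal.ofReal_mul (by linarith)]
  apply ENNReal.ofReal_le_ofReal
  have h5 : 1 - 4 * (1 - σ) ≤ (2:ℝ) ^ (-(4 - 4 * σ)) := by
    rw [Real.rpow_def_of_pos (by norm_num)]
    have := Real.add_one_le_exp (Real.log 2 * -(4 - 4 * σ))
    have h6 := Real.log_two_lt_d9
    nlinarith
  have h7 : (2:ℝ) ^ (-(4 - 4 * σ)) * q.toReal ≤ q2.toReal := by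
    have := mul_le_mul_of_nonneg_left h4' (by positivity : (0:ℝ) ≤ (2:ℝ) ^ (-(4 - 4 * σ)))
    rwa [← mul_assoc, ← Real.rpow_add (by norm_num), neg_add_cancel, Real.rpow_zero,
      one_mul] at this
  have h8 := mul_le_mul_of_nonneg_right h5 (ENNReal.toReal_nonneg (a := q))
  linarith

/-- Average over an interval. -/
def avgI (f : ℝ → ℝ) (x y : ℝ) : ℝ := (y - x)⁻¹ * ∫ s in x..y, f s

lemma avgI_jensen {f : ℝ → ℝ} (hf : Continuous f) {x y : ℝ} (hxy : x < y) (c : ℝ) :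
    ENNReal.ofReal ((y - x) * (c - avgI f x y) ^ 2) ≤
      ∫⁻ s in Set.Ioc x y, ENNReal.ofReal ((c - f s) ^ 2) := by
  have hcont : Continuous (fun s => (c - f s) ^ 2) := by fun_prop
  rw [← ofReal_integral_eq_lintegral_ofReal
    (hcont.intervalIntegrable x y).1 (Filter.Eventually.of_forall fun s => sq_nonneg _),
    ← intervalIntegral.integral_of_le hxy.le]
  apply ENNReal.ofReal_le_ofReal
  set m := avgI f x y with hm
  have hI : ∫ s in x..y, f s = (y - x) * m := by
    rw [hm, avgI, ← mul_assoc, mul_inv_cancel₀ (by linarith), one_mul]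
  have hc2 : Continuous (fun s => 2 * (c - m) * (c - f s) - (c - m) ^ 2) := by fun_prop
  have h := intervalIntegral.integral_mono_on hxy.le (hc2.intervalIntegrable (μ := volume) x y)
    (hcont.intervalIntegrable x y) (fun s _ => by nlinarith [sq_nonneg ((c - f s) - (c - m))])
  refine le_trans (le_of_eq ?_) h
  have hfi := hf.intervalIntegrable (μ := volume) x y
  rw [intervalIntegral.integral_sub ((by fun_prop : Continuous
    (fun s => 2 * (c - m) * (c - f s))).intervalIntegrable (μ := volume) x y) (by simp),
    intervalIntegral.integral_const_mul, intervalIntegral.integral_sub (by simp) hfi, hI]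
  simp
  ring

lemma avgI_two {f : ℝ → ℝ} (hf : Continuous f) {x y x' y' : ℝ} (hxy : x < y) (hxy' : x' < y') :
    ENNReal.ofReal ((y - x) * (y' - x') * (avgI f x y - avgI f x' y') ^ 2) ≤
      ∫⁻ t in Set.Ioc x y, ∫⁻ u in Set.Ioc x' y', ENNReal.ofReal ((f t - f u) ^ 2) := by
  calc ENNReal.ofReal ((y - x) * (y' - x') * (avgI f x y - avgI f x' y') ^ 2)
      = ENNReal.ofReal (y' - x') *
          ENNReal.ofReal ((y - x) * (avgI f x' y' - avgI f x y) ^ 2) := by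
        rw [← ENNReal.ofReal_mul (by linarith)]; congr 1; ring
    _ ≤ ENNReal.ofReal (y' - x') *
          ∫⁻ t in Set.Ioc x y, ENNReal.ofReal ((avgI f x' y' - f t) ^ 2) :=
        mul_le_mul_right (avgI_jensen hf hxy _) _
    _ = ∫⁻ t in Set.Ioc x y, ENNReal.ofReal (y' - x') *
          ENNReal.ofReal ((avgI f x' y' - f t) ^ 2) := by
        rw [lintegral_const_mul]
        have := hf.measurable
        fun_prop
    _ ≤ _ := by
        refine lintegral_mono fun t => ?_
        refine le_trans (le_of_eq ?_) (avgI_jensen hf hxy' (f t))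
        rw [← ENNReal.ofReal_mul (by linarith)]; congr 1; ring

lemma far_lower {σ : ℝ} (hσ : 3/4 ≤ σ) (f : ℝ → ℝ) {a b : ℝ} (hab : a < b)
    {S S' : Set ℝ} (hS : MeasurableSet S) (hS' : MeasurableSet S')
    (h1 : S ⊆ Set.Icc a b) (h2 : S' ⊆ Set.Icc a b)
    (hgap : ∀ t ∈ S, ∀ u ∈ S', (b - a) / 4 < |t - u|) :
    ∫⁻ t in S, ∫⁻ u in S', ENNReal.ofReal ((f t - f u) ^ 2) ≤
      ENNReal.ofReal ((b - a) ^ (1 + 2 * σ)) * farQ σ f a b ((b - a) / 4) := by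
  unfold farQ
  rw [← lintegral_const_mul' _ _ ENNReal.ofReal_ne_top, ← lintegral_indicator hS]
  refine lintegral_mono fun t => ?_
  by_cases ht : t ∈ S
  swap
  · rw [Set.indicator_of_notMem ht]; exact zero_le
  rw [Set.indicator_of_mem ht, ← lintegral_const_mul' _ _ ENNReal.ofReal_ne_top,
    ← lintegral_indicator hS']
  refine lintegral_mono fun u => ?_
  by_cases hu : u ∈ S'
  swap
  · rw [Set.indicator_of_notMem hu]; exact zero_le
  rw [Set.indicator_of_mem hu]
  unfold farW
  have hg := hgap t ht u hu
  rw [Set.indicator_of_mem (by exact ⟨h1 ht, h2 hu, hg⟩), ← ENNReal.ofReal_mul (by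
    have : 0 < b - a := by linarith
    positivity)]
  apply ENNReal.ofReal_le_ofReal
  dsimp only
  have hpos : 0 < |t - u| := by linarith
  have hle : |t - u| ≤ b - a := by
    rw [abs_le]; constructor <;> linarith [(h1 ht).1, (h1 ht).2, (h2 hu).1, (h2 hu).2]
  have h3 : |t - u| ^ (1 + 2 * σ) ≤ (b - a) ^ (1 + 2 * σ) :=
    Real.rpow_le_rpow hpos.le hle (by linarith)
  have h4 : |t - u| ^ (1 + 2 * σ) * |t - u| ^ (-(1:ℝ) - 2 * σ) = 1 := by
    rw [← Real.rpow_add hpos]; simp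
  have h5 : 1 ≤ (b - a) ^ (1 + 2 * σ) * |t - u| ^ (-(1:ℝ) - 2 * σ) := by
    exact h4.symm.le.trans (mul_le_mul_of_nonneg_right h3 (by positivity))
  nlinarith [sq_nonneg (f t - f u)]

/-- Average over the middle quarter of `[a,b]`. -/
def midA (f : ℝ → ℝ) (a b : ℝ) : ℝ := avgI f (a + 3/8 * (b - a)) (a + 5/8 * (b - a))

lemma midA_step {σ : ℝ} (hσ : 3/4 ≤ σ) (hσ1 : σ < 1) {f : ℝ → ℝ} (hf : Continuous f)
    {a b p : ℝ} (hab : a < b) (hp : p = a ∨ p = b) {T : ℝ≥0∞} (hT : T ≠ ⊤)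
    (hQ : nearQ σ f a b (b - a) ≤ T) :
    |midA f a b - midA f (p + (a - p) / 16) (p + (b - p) / 16)| ≤
      32 * (b - a) ^ (σ - 1/2) * Real.sqrt ((1 - σ) * T.toReal) := by
  have hL : 0 < b - a := by linarith
  have hfar : farQ σ f a b ((b - a) / 4) ≤ ENNReal.ofReal (4 * (1 - σ)) * T :=
    (farQ_le hσ1 hf hab (ne_top_of_le_ne_top hT hQ)).trans (mul_le_mul_right hQ _)
  set a' := p + (a - p) / 16 with ha'
  set b' := p + (b - p) / 16 with hb'
  have hba : b' - a' = (b - a) / 16 := by rw [ha', hb']; ring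
  have hpp : (a' = a ∧ b' = a + (b - a) / 16) ∨ (b' = b ∧ a' = b - (b - a) / 16) := by
    rcases hp with h | h
    · left; rw [ha', hb', h]; constructor <;> ring
    · right; rw [ha', hb', h]; constructor <;> ring
  have key := (avgI_two hf (x := a + 3/8 * (b - a)) (y := a + 5/8 * (b - a))
    (x' := a' + 3/8 * (b' - a')) (y' := a' + 5/8 * (b' - a')) (by linarith) (by linarith)).trans
    (far_lower hσ f hab measurableSet_Ioc measurableSet_Ioc
      (fun t ht => ⟨by linarith [ht.1], by linarith [ht.2]⟩)
      (fun t ht => by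
        obtain ⟨h1, h2⟩ := ht
        rcases hpp with ⟨h3, h4⟩ | ⟨h3, h4⟩ <;> constructor <;> linarith)
      (fun t ht u hu => by
        obtain ⟨h1, h2⟩ := ht
        obtain ⟨h5, h6⟩ := hu
        rw [lt_abs]
        rcases hpp with ⟨h3, h4⟩ | ⟨h3, h4⟩
        · left; linarith
        · right; linarith))
  have key2 := key.trans (mul_le_mul_right hfar _)
  rw [← ENNReal.ofReal_toReal hT, ← ENNReal.ofReal_mul (by linarith),
    ← ENNReal.ofReal_mul (by positivity)] at key2
  have hTn : 0 ≤ T.toReal := ENNReal.toReal_nonneg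
  have hs : 0 ≤ (1 - σ) * T.toReal := mul_nonneg (by linarith) hTn
  rw [ENNReal.ofReal_le_ofReal_iff (by
    have : 0 ≤ 4 * (1 - σ) * T.toReal := by linarith
    positivity)] at key2
  change _ * (midA f a b - midA f a' b') ^ 2 ≤ _ at key2
  set d := midA f a b - midA f a' b'
  have hpow : (b - a) ^ (1 + 2 * σ) = (b - a) ^ 2 * ((b - a) ^ (σ - 1/2)) ^ 2 := by
    rw [← Real.rpow_natCast, ← Real.rpow_natCast, ← Real.rpow_mul hL.le, ← Real.rpow_add hL]
    congr 1; push_cast; ring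
  rw [hba, hpow] at key2
  set z := (b - a) ^ (σ - 1/2)
  have hz : 0 ≤ z := by positivity
  apply abs_le_of_sq_le_sq _ (by positivity)
  rw [mul_pow, mul_pow, Real.sq_sqrt hs]
  have h2 : 0 < (b - a) ^ 2 := by positivity
  refine le_of_mul_le_mul_left ?_ h2
  linarith

lemma midA_tendsto {f : ℝ → ℝ} (hf : Continuous f) {a b p : ℝ} (hab : a < b)
    (hp : p = a ∨ p = b) :
    Filter.Tendsto (fun n : ℕ => midA f (p + (a - p) / 16 ^ n) (p + (b - p) / 16 ^ n))
      Filter.atTop (nhds (f p)) := by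
  rw [Metric.tendsto_atTop]
  intro ε hε
  obtain ⟨δ, hδ, h⟩ := Metric.continuous_iff.mp hf p (ε / 2) (by linarith)
  have hlim : Filter.Tendsto (fun n : ℕ => (b - a) * (1 / 16 : ℝ) ^ n) Filter.atTop
      (nhds ((b - a) * 0)) :=
    (tendsto_pow_atTop_nhds_zero_of_lt_one (by norm_num) (by norm_num)).const_mul _
  rw [mul_zero] at hlim
  obtain ⟨N, hN⟩ := Metric.tendsto_atTop.mp hlim δ hδ
  refine ⟨N, fun n hn => ?_⟩
  have h1 := hN n hn
  rw [Real.dist_eq, sub_zero] at h1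
  have h1 := (le_abs_self _).trans_lt h1
  set q : ℝ := (1 / 16 : ℝ) ^ n with hq
  have hq0 : 0 < q := by positivity
  have e : ∀ x : ℝ, x / 16 ^ n = x * q := fun x => by rw [hq, one_div, inv_pow]; rfl
  rw [e, e]
  set a' := p + (a - p) * q with ha'
  set b' := p + (b - p) * q with hb'
  have hba : b' - a' = (b - a) * q := by rw [ha', hb']; ring
  have hpos : 0 < (b - a) * q := mul_pos (by linarith) hq0
  have hpin : a' ≤ p ∧ p ≤ b' := by
    rcases hp with h | h
    · have : a' = p := by rw [ha', h]; ring
      constructor <;> linarith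
    · have : b' = p := by rw [hb', h]; ring
      constructor <;> linarith
  have hn := intervalIntegral.norm_integral_le_of_norm_le_const
    (a := a' + 3/8 * (b' - a')) (b := a' + 5/8 * (b' - a'))
    (f := fun s => f s - f p) (C := ε / 2) (fun s hs => by
      rw [Set.uIoc_of_le (by linarith)] at hs
      refine (h s ?_).le
      rw [Real.dist_eq, abs_lt]
      constructor <;> linarith [hs.1, hs.2, hpin.1, hpin.2])
  rw [intervalIntegral.integral_sub (hf.intervalIntegrable _ _) (by simp),
    intervalIntegral.integral_const, Real.norm_eq_abs, smul_eq_mul] at hn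
  rw [Real.dist_eq]
  have hw : 0 < a' + 5/8 * (b' - a') - (a' + 3/8 * (b' - a')) := by linarith
  unfold midA avgI
  set w := a' + 5/8 * (b' - a') - (a' + 3/8 * (b' - a'))
  set J := ∫ s in (a' + 3/8 * (b' - a'))..(a' + 5/8 * (b' - a')), f s
  have : w⁻¹ * J - f p = w⁻¹ * (J - w * f p) := by field_simp
  rw [this, abs_mul, abs_of_pos (inv_pos.mpr hw)]
  rw [abs_of_pos hw] at hn
  have : w⁻¹ * |J - w * f p| ≤ w⁻¹ * (ε / 2 * w) :=
    mul_le_mul_of_nonneg_left hn (inv_pos.mpr hw).le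
  have e2 : w⁻¹ * (ε / 2 * w) = ε / 2 := by field_simp
  linarith

lemma nearQ_mono (σ : ℝ) (f : ℝ → ℝ) {a b a' b' : ℝ} (ha : a ≤ a') (hb : b' ≤ b) :
    nearQ σ f a' b' (b' - a') ≤ nearQ σ f a b (b - a) := by
  refine lintegral_mono fun t => lintegral_mono fun u => ?_
  unfold nearW
  apply Set.indicator_le_indicator_of_subset
  · rintro p ⟨h1, h2, h3⟩
    exact ⟨⟨ha.trans h1.1, h1.2.trans hb⟩, ⟨ha.trans h2.1, h2.2.trans hb⟩, by linarith⟩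
  · intro _; exact zero_le

lemma chain {σ : ℝ} (hσ : 3/4 ≤ σ) (hσ1 : σ < 1) {f : ℝ → ℝ} (hf : Continuous f)
    {a b p : ℝ} (hab : a < b) (hp : p = a ∨ p = b) {T : ℝ≥0∞} (hT : T ≠ ⊤)
    (hQ : nearQ σ f a b (b - a) ≤ T) :
    |midA f a b - f p| ≤ 64 * (b - a) ^ (σ - 1/2) * Real.sqrt ((1 - σ) * T.toReal) := by
  have hL : 0 < b - a := by linarith
  have h := dist_le_of_le_geometric_of_tendsto₀ (1/2 : ℝ)
    (32 * (b - a) ^ (σ - 1/2) * Real.sqrt ((1 - σ) * T.toReal)) (by norm_num)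
    (f := fun n : ℕ => midA f (p + (a - p) / 16 ^ n) (p + (b - p) / 16 ^ n))
    (fun n => ?_) (midA_tendsto hf hab hp)
  · simp only [pow_zero, div_one, add_sub_cancel, Real.dist_eq] at h
    refine h.trans (le_of_eq ?_)
    ring
  · have hpow : (0:ℝ) < 16 ^ n := by positivity
    have h16 : (1:ℝ) ≤ 16 ^ n := one_le_pow₀ (by norm_num)
    have hd : p + (b - p) / 16 ^ n - (p + (a - p) / 16 ^ n) = (b - a) / 16 ^ n := by ring
    have hdl : (b - a) / 16 ^ n ≤ b - a := div_le_self hL.le h16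
    have hstep := midA_step hσ hσ1 hf (a := p + (a - p) / 16 ^ n) (b := p + (b - p) / 16 ^ n)
      (p := p) (by have : 0 < (b - a) / 16 ^ n := by positivity
                   linarith)
      (by rcases hp with h | h
          · left; rw [h]; simp
          · right; rw [h]; simp) hT
      ((nearQ_mono σ f (by
          rcases hp with h | h
          · rw [h]; simp
          · have : (a - p) / 16 ^ n = - ((b - a) / 16 ^ n) := by rw [h]; ring
            linarith) (by
          rcases hp with h | h
          · have : (b - p) / 16 ^ n = ((b - a) / 16 ^ n) := by rw [h]
            linarith
          · rw [h]; simp)).trans hQ)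
    rw [Real.dist_eq]
    rw [hd] at hstep
    have e : ∀ x : ℝ, p + (p + (x - p) / 16 ^ n - p) / 16 = p + (x - p) / 16 ^ (n + 1) := by
      intro x; rw [pow_succ]; field_simp; ring
    rw [e, e] at hstep
    refine hstep.trans ?_
    have hr : ((b - a) / 16 ^ n) ^ (σ - 1/2) ≤ (b - a) ^ (σ - 1/2) * (1/2) ^ n := by
      rw [div_eq_mul_inv, Real.mul_rpow hL.le (by positivity)]
      refine mul_le_mul_of_nonneg_left ?_ (by positivity)
      have e1 : ((16:ℝ) ^ n)⁻¹ = (1/2) ^ ((4:ℝ) * n) := by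
        rw [Real.rpow_mul (by norm_num), Real.rpow_natCast, ← inv_pow]; congr 1; norm_num
      rw [e1, ← Real.rpow_mul (by norm_num), ← Real.rpow_natCast]
      apply Real.rpow_le_rpow_of_exponent_ge (by norm_num) (by norm_num)
      have : (0:ℝ) ≤ n := by positivity
      nlinarith
    have hsq := Real.sqrt_nonneg ((1 - σ) * T.toReal)
    calc _ ≤ 32 * ((b - a) ^ (σ - 1/2) * (1/2) ^ n) * Real.sqrt ((1 - σ) * T.toReal) := by
          gcongr
      _ = _ := by ring

lemma holder {σ : ℝ} (hσ : 3/4 ≤ σ) (hσ1 : σ < 1) {f : ℝ → ℝ} (hf : Continuous f)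
    {a b : ℝ} (hab : a < b) (h16 : b - a ≤ 16) {T : ℝ≥0∞} (hT : T ≠ ⊤)
    (hQ : nearQ σ f a b (b - a) ≤ T) :
    |f a - f b| ≤ 256 * (b - a) ^ (1/4 : ℝ) * Real.sqrt ((1 - σ) * T.toReal) := by
  have h1 := chain hσ hσ1 hf hab (Or.inl rfl) hT hQ
  have h2 := chain hσ hσ1 hf hab (Or.inr rfl) hT hQ
  have hL : 0 < b - a := by linarith
  have h3 : (b - a) ^ (σ - 1/2) ≤ 2 * (b - a) ^ (1/4 : ℝ) := by
    rw [show σ - 1/2 = (σ - 3/4) + 1/4 by ring, Real.rpow_add hL]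
    refine mul_le_mul_of_nonneg_right ?_ (by positivity)
    calc (b - a) ^ (σ - 3/4) ≤ 16 ^ (σ - 3/4) := Real.rpow_le_rpow hL.le h16 (by linarith)
      _ ≤ 16 ^ (1/4 : ℝ) := Real.rpow_le_rpow_of_exponent_le (by norm_num) (by linarith)
      _ = 2 := by
        rw [show (16:ℝ) = 2 ^ (4:ℝ) by norm_num, ← Real.rpow_mul (by norm_num)]; norm_num
  have hsq := Real.sqrt_nonneg ((1 - σ) * T.toReal)
  have h4 := mul_le_mul_of_nonneg_right h3 hsq
  have h5 := abs_sub_le (f a) (midA f a b) (f b)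
  rw [abs_sub_comm (f a) (midA f a b)] at h5
  linarith

lemma holder_main {σ : ℝ} (hσ : 3/4 ≤ σ) (hσ1 : σ < 1) {f : ℝ → ℝ}
    (hf : ContinuousOn f (Set.Icc 0 (5 * Real.pi))) (hH : Hseminorm σ f ≠ ⊤) :
    ∀ t ∈ Set.Icc 0 (5 * Real.pi), ∀ u ∈ Set.Icc 0 (5 * Real.pi),
      |f t - f u| ≤ 256 * |t - u| ^ (1/4 : ℝ) * (Hseminorm σ f).toReal := by
  have hpi : (0:ℝ) < 5 * Real.pi := by positivity
  set g : ℝ → ℝ := Set.IccExtend hpi.le (Set.domRestrict (Set.Icc 0 (5 * Real.pi)) f) with hg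
  have hgc : Continuous g := (continuousOn_iff_continuous_domRestrict.mp hf).Icc_extend'
  have hfg : ∀ x ∈ Set.Icc 0 (5 * Real.pi), g x = f x := fun x hx => by
    rw [hg, Set.IccExtend_of_mem _ _ hx]; rfl
  set T := ∫⁻ t in Set.Icc 0 (5 * Real.pi), ∫⁻ u in Set.Icc 0 (5 * Real.pi),
      ENNReal.ofReal ((f t - f u) ^ 2 * |t - u| ^ (-(1:ℝ) - 2 * σ)) with hTdef
  have hHT : Hseminorm σ f = (ENNReal.ofReal (1 - σ) * T) ^ (1/2 : ℝ) := rfl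
  have hT : T ≠ ⊤ := by
    intro h
    apply hH
    rw [hHT, h, ENNReal.mul_top (by simpa using hσ1), ENNReal.top_rpow_of_pos (by norm_num)]
  have hHr : (Hseminorm σ f).toReal = Real.sqrt ((1 - σ) * T.toReal) := by
    rw [hHT, ← ENNReal.toReal_rpow, ENNReal.toReal_mul, ENNReal.toReal_ofReal (by linarith),
      Real.sqrt_eq_rpow]
  have hQ : nearQ σ g 0 (5 * Real.pi) (5 * Real.pi - 0) ≤ T := by
    rw [hTdef, ← lintegral_indicator measurableSet_Icc]
    refine lintegral_mono fun t => ?_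
    by_cases ht : t ∈ Set.Icc 0 (5 * Real.pi)
    · rw [Set.indicator_of_mem ht, ← lintegral_indicator measurableSet_Icc]
      refine lintegral_mono fun u => ?_
      by_cases hu : u ∈ Set.Icc 0 (5 * Real.pi)
      · rw [Set.indicator_of_mem hu]
        unfold nearW
        refine (Set.indicator_le_self _ _ _).trans ?_
        simp only [hfg t ht, hfg u hu]
        exact le_rfl
      · unfold nearW
        rw [Set.indicator_of_notMem (fun h => hu h.2.1)]
        exact zero_le
    · refine le_of_eq_of_le ?_ zero_le
      rw [lintegral_eq_zero_of_ae_eq_zero]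
      refine Filter.Eventually.of_forall fun u => ?_
      unfold nearW
      exact Set.indicator_of_notMem (fun h => ht h.1) _
  have main : ∀ t ∈ Set.Icc 0 (5 * Real.pi), ∀ u ∈ Set.Icc 0 (5 * Real.pi), t < u →
      |f t - f u| ≤ 256 * |t - u| ^ (1/4 : ℝ) * (Hseminorm σ f).toReal := by
    intro t ht u hu htu
    have := holder hσ hσ1 hgc htu (by linarith [ht.1, hu.2, Real.pi_lt_d2]) hT
      ((nearQ_mono σ g ht.1 hu.2).trans hQ)
    rw [hfg t ht, hfg u hu] at this
    rw [hHr, abs_sub_comm t u, abs_of_pos (by linarith : 0 < u - t)]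
    exact this
  intro t ht u hu
  rcases lt_trichotomy t u with h | h | h
  · exact main t ht u hu h
  · subst h
    rw [sub_self, abs_zero]; positivity
  · rw [abs_sub_comm, abs_sub_comm t]; exact main u hu t ht h

/-- a uniform-in-`σ` fractional embedding `H^σ([0,5π]) ↪ C^{1/4}([0,5π])`
for `σ ∈ [3/4,1)`: `sup_I |f − f̄| ≤ C [f]_{H^σ(I)}` and
`|f(t)−f(t̄)| ≤ C [f]_{H^σ(I)} |t−t̄|^{1/4}`. -/
theorem fractional_sobolev_embedding :
    ∃ C : ℝ, 0 < C ∧ ∀ σ ∈ Set.Ico (3/4 : ℝ) 1, ∀ f : ℝ → ℝ,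
      ContinuousOn f (Set.Icc 0 (5 * Real.pi)) →
      (∀ t ∈ Set.Icc 0 (5 * Real.pi),
        ENNReal.ofReal |f t - (5 * Real.pi)⁻¹ * ∫ u in (0:ℝ)..(5 * Real.pi), f u|
          ≤ ENNReal.ofReal C * Hseminorm σ f) ∧
      (∀ t ∈ Set.Icc 0 (5 * Real.pi), ∀ u ∈ Set.Icc 0 (5 * Real.pi),
        ENNReal.ofReal |f t - f u|
          ≤ ENNReal.ofReal C * Hseminorm σ f * ENNReal.ofReal (|t - u| ^ (1/4 : ℝ))) := by
  refine ⟨512, by norm_num, ?_⟩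
  rintro σ ⟨hσ, hσ1⟩ f hf
  have hpi : (0:ℝ) < 5 * Real.pi := by positivity
  by_cases hH : Hseminorm σ f = ⊤
  · rw [hH, ENNReal.mul_top (by simp)]
    refine ⟨fun _ _ => le_top, fun t _ u _ => ?_⟩
    by_cases htu : t = u
    · subst htu; simp
    · rw [ENNReal.top_mul]
      · exact le_top
      · have : 0 < |t - u| := abs_pos.mpr (sub_ne_zero.mpr htu)
        have : 0 < |t - u| ^ (1/4 : ℝ) := by positivity
        simpa using this
  have hm := holder_main hσ hσ1 hf hH
  rw [← ENNReal.ofReal_toReal hH]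
  set S := (Hseminorm σ f).toReal
  have hS : 0 ≤ S := ENNReal.toReal_nonneg
  constructor
  · intro t ht
    rw [← ENNReal.ofReal_mul (by norm_num)]
    apply ENNReal.ofReal_le_ofReal
    have h := intervalIntegral.norm_integral_le_of_norm_le_const
      (a := 0) (b := 5 * Real.pi) (f := fun u => f t - f u) (C := 512 * S) (fun u hu => by
        rw [Set.uIoc_of_le hpi.le] at hu
        have hu' : u ∈ Set.Icc 0 (5 * Real.pi) := ⟨hu.1.le, hu.2⟩
        rw [Real.norm_eq_abs]
        refine (hm t ht u hu').trans ?_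
        have h16 : |t - u| ≤ 16 := by
          rw [abs_le]
          constructor <;> linarith [ht.1, ht.2, hu'.1, hu'.2, Real.pi_lt_d2]
        have : |t - u| ^ (1/4 : ℝ) ≤ 2 := by
          calc |t - u| ^ (1/4 : ℝ) ≤ 16 ^ (1/4 : ℝ) :=
                Real.rpow_le_rpow (abs_nonneg _) h16 (by norm_num)
            _ = 2 := by
              rw [show (16:ℝ) = 2 ^ (4:ℝ) by norm_num, ← Real.rpow_mul (by norm_num)]; norm_num
        nlinarith)
    have hfi : IntervalIntegrable f volume 0 (5 * Real.pi) :=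
      ContinuousOn.intervalIntegrable (by rwa [Set.uIcc_of_le hpi.le])
    rw [intervalIntegral.integral_sub (by simp) hfi, intervalIntegral.integral_const,
      Real.norm_eq_abs, smul_eq_mul, sub_zero, abs_of_pos hpi] at h
    set J := ∫ u in (0:ℝ)..(5 * Real.pi), f u
    have e : f t - (5 * Real.pi)⁻¹ * J = (5 * Real.pi)⁻¹ * (5 * Real.pi * f t - J) := by
      field_simp
    rw [e, abs_mul, abs_of_pos (inv_pos.mpr hpi), inv_mul_le_iff₀ hpi]
    linarith
  · intro t ht u hu
    rw [← ENNReal.ofReal_mul (by norm_num), ← ENNReal.ofReal_mul (by positivity)]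
    apply ENNReal.ofReal_le_ofReal
    refine (hm t ht u hu).trans ?_
    have : 0 ≤ |t - u| ^ (1/4 : ℝ) * S := by positivity
    nlinarith
end
end
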